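/- arXiv:0809.4169 — 7 statements merged into one kernel-verified Lean document; each statement's English description precedes it below -/
import Mathlib

section
/- If Φ : A → B is a flat epimorphism of commutative rings (B is flat as an A-module and Φ is an epimorphism in the category of rings) and A is strong n-perfect, then B is strong n-perfect. -/
open CategoryTheory CategoryTheory.Limits

noncomputable section

universe u

/-- `pdLE R M n` : the projective dimension of the `R`-module `M` is at most `n`,
expressed by the vanishing of `Ext^{n+1}(M, N)` for all `N`. -/
def pdLE (R : Type u) [CommRing R] (M : Type u) [AddCommGroup M] [Module R M] (n : ℕ) : Prop :=
  ∀ N : ModuleCat.{u} R,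
    IsZero (((Ext R (ModuleCat.{u} R) (n + 1)).obj (Opposite.op (ModuleCat.of R M))).obj N)

/-- `fdLE R M n` : the flat dimension of the `R`-module `M` is at most `n`,
expressed by the vanishing of `Tor_{n+1}(M, N)` for all `N`. -/
def fdLE (R : Type u) [CommRing R] (M : Type u) [AddCommGroup M] [Module R M] (n : ℕ) : Prop :=
  ∀ N : ModuleCat.{u} R,
    IsZero (((Tor' (ModuleCat.{u} R) (n + 1)).obj (ModuleCat.of R M)).obj N)

/-- A commutative ring `R` is strong `n`-perfect if every `R`-module of flat dimension
at most `n` has projective dimension at most `n`. -/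
def IsStrongNPerfect (R : Type u) [CommRing R] (n : ℕ) : Prop :=
  ∀ (M : Type u) [AddCommGroup M] [Module R M], fdLE R M n → pdLE R M n

namespace FlatEpi

open MonoidalCategory

/-- the short complex in degrees `n+2, n+1, n`. -/
abbrev sc3 {C : Type*} [Category C] [Abelian C] (K : ChainComplex C ℕ) (n : ℕ) : ShortComplex C :=
  ShortComplex.mk _ _ (K.d_comp_d (n + 2) (n + 1) n)

lemma leftDerived_zero_iff {C D : Type*} [Category C] [Abelian C] [HasProjectiveResolutions C]
    [Category D] [Abelian D] (F : C ⥤ D) [F.Additive] {X : C} (P : ProjectiveResolution X) (n : ℕ) :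
    IsZero ((F.leftDerived (n + 1)).obj X) ↔ ((sc3 P.complex n).map F).Exact := by
  rw [(P.isoLeftDerivedObj F (n + 1)).isZero_iff]
  erw [← HomologicalComplex.exactAt_iff_isZero_homology]
  exact HomologicalComplex.exactAt_iff' _ (n + 2) (n + 1) n (by simp only [ChainComplex.prev]; rfl)
    (by simp)

lemma map_leftDerived_zero {C D D' : Type*} [Category C] [Abelian C] [HasProjectiveResolutions C]
    [Category D] [Abelian D] [Category D'] [Abelian D'] (F : C ⥤ D) [F.Additive]
    (E : D ⥤ D') [E.Additive] [E.PreservesHomology]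
    {X : C} (P : ProjectiveResolution X) (n : ℕ) (h : (((sc3 P.complex n).map F).map E).Exact) :
    IsZero (E.obj ((F.leftDerived (n + 1)).obj X)) := by
  have h3 : IsZero (E.obj ((sc3 P.complex n).map F).homology) :=
    ((ShortComplex.exact_iff_isZero_homology _).1 h).of_iso
      (((sc3 P.complex n).map F).mapHomologyIso E).symm
  refine h3.of_iso (E.mapIso (P.isoLeftDerivedObj F (n+1) ≪≫ ?_))
  exact ShortComplex.homologyMapIso (((F.mapHomologicalComplex _).obj P.complex).isoSc'
    (n+2) (n+1) n (by simp only [ChainComplex.prev]; rfl) (by simp))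

lemma leftDerived_map_add {C D : Type*} [Category C] [Abelian C] [HasProjectiveResolutions C]
    [Category D] [Abelian D] (F : C ⥤ D) [F.Additive] {X Y : C} (f g : X ⟶ Y) (n : ℕ) :
    (F.leftDerived n).map (f + g) = (F.leftDerived n).map f + (F.leftDerived n).map g := by
  let P := projectiveResolution X
  let Q := projectiveResolution Y
  let f' := ProjectiveResolution.lift f P Q
  let g' := ProjectiveResolution.lift g P Q
  have hf := ProjectiveResolution.lift_commutes f P Q
  have hg := ProjectiveResolution.lift_commutes g P Q
  rw [F.leftDerived_map_eq n f f' hf, F.leftDerived_map_eq n g g' hg,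
    F.leftDerived_map_eq n (f + g) (f' + g')]
  · rw [Functor.map_add, Preadditive.add_comp, Preadditive.comp_add]
  · rw [Preadditive.add_comp, hf, hg, Functor.map_add, Preadditive.comp_add]

lemma leftDerived_map_smul {R : Type*} [CommRing R] {C D : Type*} [Category C] [Abelian C]
    [HasProjectiveResolutions C] [Linear R C]
    [Category D] [Abelian D] [Linear R D] (F : C ⥤ D) [F.Additive] [F.Linear R]
    {X Y : C} (a : R) (f : X ⟶ Y) (n : ℕ) :
    (F.leftDerived n).map (a • f) = a • (F.leftDerived n).map f := by
  let P := projectiveResolution X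
  let Q := projectiveResolution Y
  let f' := ProjectiveResolution.lift f P Q
  have hf := ProjectiveResolution.lift_commutes f P Q
  rw [F.leftDerived_map_eq n f f' hf, F.leftDerived_map_eq n (a • f) (a • f')]
  · have : (F.mapHomologicalComplex (ComplexShape.down ℕ) ⋙
        HomologicalComplex.homologyFunctor _ _ n).map (a • f') =
        a • (F.mapHomologicalComplex (ComplexShape.down ℕ) ⋙
        HomologicalComplex.homologyFunctor _ _ n).map f' := by
      have h1 : (F.mapHomologicalComplex (ComplexShape.down ℕ)).map (a • f') =
        a • (F.mapHomologicalComplex (ComplexShape.down ℕ)).map f' := by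
        ext i
        exact F.map_smul _ _
      rw [Functor.comp_map, h1]
      exact ShortComplex.homologyMap_smul (S₁ := HomologicalComplex.sc _ n)
        (S₂ := HomologicalComplex.sc _ n) ((HomologicalComplex.shortComplexFunctor D
          (ComplexShape.down ℕ) n).map ((F.mapHomologicalComplex (ComplexShape.down ℕ)).map f')) a
    rw [this, Linear.smul_comp, Linear.comp_smul]
  · rw [Linear.smul_comp, hf]
    ext
    simp
    exact (Linear.comp_smul _ _ _ _ _ _).symm

variable {A B : Type u} [CommRing A] [CommRing B] (Φ : A →+* B)

lemma isEpi (hepi : ∀ (C : Type u) [CommRing C] (f g : B →+* C), f.comp Φ = g.comp Φ → f = g) :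
    letI := Φ.toAlgebra; Algebra.IsEpi A B := by
  letI := Φ.toAlgebra
  rw [Algebra.isEpi_iff_forall_one_tmul_eq]
  intro b
  have := hepi (TensorProduct A B B) (Algebra.TensorProduct.includeRight (R := A)).toRingHom
    (Algebra.TensorProduct.includeLeft (R := A) (S := A)).toRingHom (by
      ext a
      have h1 := (Algebra.TensorProduct.includeRight (R := A) (A := B) (B := B)).commutes a
      have h2 := (Algebra.TensorProduct.includeLeft (R := A) (S := A) (A := B) (B := B)).commutes a
      exact h1.trans h2.symm)
  exact RingHom.congr_fun this b

/-- extension of a restriction is the module itself. -/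
def extIso (hepi : letI := Φ.toAlgebra; Algebra.IsEpi A B) (M : ModuleCat.{u} B) :
    (ModuleCat.extendScalars Φ).obj ((ModuleCat.restrictScalars Φ).obj M) ≅ M :=
  letI := Φ.toAlgebra
  letI : Module A M := Module.compHom M Φ
  haveI : IsScalarTower A B M := ⟨fun a b m => by
    rw [Algebra.smul_def, mul_smul]; rfl⟩
  haveI : Algebra.IsEpi A B := hepi
  (TensorProduct.lid' A B M).toModuleIso

lemma preservesHomology (hflat : Φ.Flat) :
    (ModuleCat.extendScalars.{u, u, u} Φ).PreservesHomology := by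
  have := ModuleCat.preservesFiniteLimits_extendScalars_of_flat hflat
  infer_instance

instance : (ModuleCat.extendScalars.{u, u, u} Φ).Additive :=
  (ModuleCat.extendRestrictScalarsAdj Φ).left_adjoint_additive

instance : (ModuleCat.extendScalars.{u, u, u} Φ).PreservesProjectiveObjects where
  projective_obj := fun {P} hP => (ModuleCat.extendRestrictScalarsAdj Φ).map_projective P hP

/-- scalar multiplication as an `A`-linear map. -/
def act (M : ModuleCat.{u} B) (b : B) :
    (ModuleCat.restrictScalars Φ).obj M ⟶ (ModuleCat.restrictScalars Φ).obj M :=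
  (ModuleCat.restrictScalars Φ).map (ModuleCat.ofHom (LinearMap.lsmul B M b))

lemma isZero_of_act (T : ModuleCat.{u} A) (ρ : B → (T ⟶ T)) (h1 : ρ 1 = 𝟙 T)
    (hadd : ∀ b c, ρ (b + c) = ρ b + ρ c) (hsmul : ∀ a b, ρ (Φ a * b) = a • ρ b)
    (hz : IsZero ((ModuleCat.extendScalars Φ).obj T)) : IsZero T := by
  letI := Φ.toAlgebra
  let L : B →ₗ[A] T →ₗ[A] T :=
    { toFun b := (ρ b).hom
      map_add' b c := by rw [hadd]; rfl
      map_smul' a b := by rw [Algebra.smul_def]; erw [hsmul]; rfl }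
  have hs : Subsingleton (TensorProduct A B T) := ModuleCat.subsingleton_of_isZero hz
  apply ModuleCat.isZero_of_iff_subsingleton.2
  refine subsingleton_of_forall_eq 0 fun t => ?_
  have : TensorProduct.lift L (1 ⊗ₜ t) = t := by
    simp [L, h1]
  rw [← this, Subsingleton.elim (1 ⊗ₜ[A] t : TensorProduct A B T) 0, map_zero]

/-- base change commutes with tensoring -/
def baseChangeTensor (N : ModuleCat.{u} A) :
    (tensoringRight (ModuleCat.{u} A)).obj N ⋙ ModuleCat.extendScalars Φ ≅
    ModuleCat.extendScalars Φ ⋙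
      (tensoringRight (ModuleCat.{u} B)).obj ((ModuleCat.extendScalars Φ).obj N) :=
  NatIso.ofComponents (fun X => (Functor.Monoidal.μIso (ModuleCat.extendScalars Φ) X N).symm)
    (fun f => by simp)

lemma fd_restrict (hflat : Φ.Flat) (hepi : letI := Φ.toAlgebra; Algebra.IsEpi A B)
    (M : ModuleCat.{u} B) (n : ℕ) (h : fdLE B M n) :
    fdLE A ((ModuleCat.restrictScalars Φ).obj M) n := by
  intro N
  have := preservesHomology Φ hflat
  let E : ModuleCat.{u} A ⥤ ModuleCat.{u} B := ModuleCat.extendScalars.{u, u, u} Φ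
  have : E.Additive := inferInstanceAs (ModuleCat.extendScalars.{u, u, u} Φ).Additive
  let X := (ModuleCat.restrictScalars Φ).obj M
  let P : ProjectiveResolution X := projectiveResolution X
  have h1 : IsZero ((((tensoringRight (ModuleCat.{u} B)).obj (E.obj N)).leftDerived (n+1)).obj
      (E.obj X)) :=
    (h (E.obj N)).of_iso ((((tensoringRight (ModuleCat.{u} B)).obj
      (E.obj N)).leftDerived (n+1)).mapIso (extIso Φ hepi M))
  rw [leftDerived_zero_iff _ (E.mapProjectiveResolution P)] at h1
  let S := sc3 P.complex n
  let F := (tensoringRight (ModuleCat.{u} A)).obj N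
  have h2 : ((S.map F).map E).Exact :=
    (ShortComplex.exact_iff_of_iso (S.mapNatIso (baseChangeTensor Φ N))).2 h1
  change IsZero ((F.leftDerived (n+1)).obj X)
  refine isZero_of_act Φ _ (fun b => (F.leftDerived (n+1)).map (act Φ M b)) ?_ ?_ ?_ ?_
  · have : act Φ M 1 = 𝟙 X := by
      ext x
      exact one_smul B _
    exact (congrArg _ this).trans ((F.leftDerived (n + 1)).map_id X)
  · intro b c
    have : act Φ M (b + c) = act Φ M b + act Φ M c := by
      ext x
      exact add_smul b c _
    exact (congrArg _ this).trans (leftDerived_map_add F _ _ _)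
  · intro a b
    have : act Φ M (Φ a * b) = a • act Φ M b := by
      ext x
      exact mul_smul _ _ _
    have hF : F.Linear A := inferInstanceAs ((tensorRight N).Linear A)
    exact (congrArg _ this).trans (leftDerived_map_smul F a _ _)
  · exact map_leftDerived_zero F E P n h2

lemma ext_zero_iff {R : Type u} [CommRing R] {X : ModuleCat.{u} R} (P : ProjectiveResolution X)
    (N : ModuleCat.{u} R) (n : ℕ) :
    IsZero (((Ext R (ModuleCat.{u} R) (n + 1)).obj (Opposite.op X)).obj N) ↔
    ∀ f : P.complex.X (n + 1) ⟶ N, P.complex.d (n + 2) (n + 1) ≫ f = 0 →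
      ∃ g : P.complex.X n ⟶ N, P.complex.d (n + 1) n ≫ g = f := by
  rw [(P.isoExt (n + 1) N).isZero_iff, ← HomologicalComplex.exactAt_iff_isZero_homology,
    HomologicalComplex.exactAt_iff' _ n (n + 1) (n + 2) (by simp) (by simp),
    ShortComplex.moduleCat_exact_iff]
  rfl

lemma pd_extend (hflat : Φ.Flat) (hepi : letI := Φ.toAlgebra; Algebra.IsEpi A B)
    (M : ModuleCat.{u} B) (n : ℕ) (h : pdLE A ((ModuleCat.restrictScalars Φ).obj M) n) :
    pdLE B M n := by
  intro N
  have := preservesHomology Φ hflat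
  let E : ModuleCat.{u} A ⥤ ModuleCat.{u} B := ModuleCat.extendScalars.{u, u, u} Φ
  have : E.Additive := inferInstanceAs (ModuleCat.extendScalars.{u, u, u} Φ).Additive
  let X := (ModuleCat.restrictScalars Φ).obj M
  let P : ProjectiveResolution X := projectiveResolution X
  let adj := ModuleCat.extendRestrictScalarsAdj.{u, u, u} Φ
  have h1 := (ext_zero_iff P ((ModuleCat.restrictScalars Φ).obj N) n).1 (h _)
  suffices h2 : IsZero (((Ext B (ModuleCat.{u} B) (n + 1)).obj
      (Opposite.op (E.obj X))).obj N) from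
    h2.of_iso (((Ext B (ModuleCat.{u} B) (n + 1)).mapIso (extIso Φ hepi M).op).app N)
  rw [ext_zero_iff (E.mapProjectiveResolution P)]
  intro f hf
  let f2 : (ModuleCat.extendScalars Φ).obj (P.complex.X (n + 1)) ⟶ N := f
  have hf2 : (ModuleCat.extendScalars Φ).map (P.complex.d (n + 2) (n + 1)) ≫ f2 = 0 := hf
  obtain ⟨g, hg⟩ := h1 (adj.homEquiv _ _ f2) (by
    refine (adj.homEquiv_naturality_left _ _).symm.trans ?_
    rw [hf2, adj.homEquiv_unit, Functor.map_zero, comp_zero])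
  refine ⟨(adj.homEquiv _ _).symm g, ?_⟩
  change (ModuleCat.extendScalars Φ).map (P.complex.d (n + 1) n) ≫ (adj.homEquiv _ _).symm g = f2
  apply (adj.homEquiv _ _).injective
  refine (adj.homEquiv_naturality_left _ _).trans ?_
  rw [Equiv.apply_symm_apply]
  exact hg

end FlatEpi

theorem strongNPerfect_of_flat_epimorphism
    (A B : Type u) [CommRing A] [CommRing B] (Φ : A →+* B)
    (hflat : letI := Φ.toAlgebra; Module.Flat A B)
    (hepi : ∀ (C : Type u) [CommRing C] (f g : B →+* C), f.comp Φ = g.comp Φ → f = g)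
    (n : ℕ) (hA : IsStrongNPerfect A n) :
    IsStrongNPerfect B n := by
  intro M _ _ h
  have he := FlatEpi.isEpi Φ hepi
  exact FlatEpi.pd_extend Φ hflat he (ModuleCat.of B M) n
    (hA _ (FlatEpi.fd_restrict Φ hflat he (ModuleCat.of B M) n h))
end
end

section
/- If A is a strong n-perfect commutative ring and S is a multiplicative subset of A, then the localization S⁻¹A is a strong n-perfect ring. -/
open CategoryTheory CategoryTheory.Limits

noncomputable section

universe u

open scoped TensorProduct

lemma fd_bridge (R : Type u) [CommRing R] (M : Type u) [AddCommGroup M] [Module R M] (n : ℕ)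
    (P : ProjectiveResolution (ModuleCat.of R M)) :
    fdLE R M n ↔ ∀ (N : Type u) [AddCommGroup N] [Module R N],
      Function.Exact ((P.complex.d (n+2) (n+1)).hom.rTensor N)
        ((P.complex.d (n+1) n).hom.rTensor N) := by
  have key : ∀ N : ModuleCat.{u} R,
      IsZero (((Tor' (ModuleCat.{u} R) (n + 1)).obj (ModuleCat.of R M)).obj N) ↔
      Function.Exact ((P.complex.d (n+2) (n+1)).hom.rTensor N)
        ((P.complex.d (n+1) n).hom.rTensor N) := by
    intro N
    rw [Tor'_obj_obj, Iso.isZero_iff (P.isoLeftDerivedObj ((MonoidalCategory.tensoringRight (ModuleCat.{u} R)).obj N) (n+1))]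
    erw [← HomologicalComplex.exactAt_iff_isZero_homology]
    rw [HomologicalComplex.exactAt_iff' _ (n + 2) (n + 1) n (by simp only [ChainComplex.prev]; rfl)
    (by simp), ShortComplex.ShortExact.moduleCat_exact_iff_function_exact]
    rfl
  exact ⟨fun h N _ _ => (key (ModuleCat.of R N)).1 (h _), fun h N => (key N).2 (h N)⟩

lemma pd_bridge (R : Type u) [CommRing R] (M : Type u) [AddCommGroup M] [Module R M] (n : ℕ)
    (P : ProjectiveResolution (ModuleCat.of R M)) :
    pdLE R M n ↔ ∀ (N : Type u) [AddCommGroup N] [Module R N] (φ : P.complex.X (n+1) →ₗ[R] N),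
      φ ∘ₗ (P.complex.d (n+2) (n+1)).hom = 0 → 
        ∃ ψ : P.complex.X n →ₗ[R] N, ψ ∘ₗ (P.complex.d (n+1) n).hom = φ := by
  have key : ∀ N : ModuleCat.{u} R,
      IsZero (((Ext R (ModuleCat.{u} R) (n + 1)).obj (Opposite.op (ModuleCat.of R M))).obj N) ↔
      ∀ (φ : P.complex.X (n+1) ⟶ N),
      (P.complex.d (n+2) (n+1)) ≫ φ = 0 → 
        ∃ ψ : P.complex.X n ⟶ N, (P.complex.d (n+1) n) ≫ ψ = φ := by
    intro N
    rw [Iso.isZero_iff (P.isoExt (n+1) N)]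
    rw [← HomologicalComplex.exactAt_iff_isZero_homology]
    rw [HomologicalComplex.exactAt_iff' _ n (n + 1) (n+2) (by simp) (by simp only [CochainComplex.next]; rfl), ShortComplex.moduleCat_exact_iff]
    rfl
  constructor
  · intro h N _ _ φ hφ
    obtain ⟨ψ, hψ⟩ := (key (ModuleCat.of R N)).1 (h _) (ModuleCat.ofHom φ) (by ext1; exact hφ)
    exact ⟨ψ.hom, congrArg ModuleCat.Hom.hom hψ⟩
  · intro h N
    refine (key N).2 fun φ hφ => ?_
    obtain ⟨ψ, hψ⟩ := h N φ.hom (congrArg ModuleCat.Hom.hom hφ)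
    exact ⟨ModuleCat.ofHom ψ, by ext1; exact hψ⟩

lemma res_exact {R : Type u} [CommRing R] {M : ModuleCat.{u} R} (P : ProjectiveResolution M)
    (n : ℕ) : Function.Exact (P.complex.d (n+2) (n+1)).hom (P.complex.d (n+1) n).hom :=
  (ShortComplex.ShortExact.moduleCat_exact_iff_function_exact _).1 (P.exact_succ n)

lemma res_exact₀ {R : Type u} [CommRing R] {M : ModuleCat.{u} R} (P : ProjectiveResolution M) :
    ∃ e : P.complex.X 0 →ₗ[R] M, Function.Surjective e ∧
      Function.Exact (P.complex.d 1 0).hom e :=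
  ⟨(P.π.f 0).hom, (ModuleCat.epi_iff_surjective (P.π.f 0)).1 inferInstance,
  (ShortComplex.ShortExact.moduleCat_exact_iff_function_exact _).1 P.exact₀⟩

lemma res_proj {R : Type u} [CommRing R] {M : ModuleCat.{u} R} (P : ProjectiveResolution M)
    (n : ℕ) : Module.Projective R (P.complex.X n) :=
  (IsProjective.iff_projective _).2 (P.projective n)

open scoped TensorProduct

section elem
variable {R : Type u} [CommRing R]

lemma rTensor_inj_of_flat {K F G : Type u} [AddCommGroup K] [Module R K] [AddCommGroup F] [Module R F]
    [AddCommGroup G] [Module R G] {i : K →ₗ[R] F} {g : F →ₗ[R] G} (hi : Function.Injective i)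
    (hg : Function.Surjective g) (h : Function.Exact i g) [Module.Flat R G]
    (N : Type u) [AddCommGroup N] [Module R N] : Function.Injective (i.rTensor N) :=
  (LinearMap.lTensor_inj_iff_rTensor_inj N i).1
    (LinearMap.lTensor_injective_of_exact_of_flat g hg i hi h N)

lemma flat_ker {K F G : Type u} [AddCommGroup K] [Module R K] [AddCommGroup F] [Module R F]
    [AddCommGroup G] [Module R G] {i : K →ₗ[R] F} {g : F →ₗ[R] G} (hi : Function.Injective i)
    (hg : Function.Surjective g) (h : Function.Exact i g) [Module.Flat R F] [Module.Flat R G] :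
    Module.Flat R K := by
  rw [Module.Flat.iff_lTensor_preserves_injective_linearMap]
  intro N' N _ _ _ _ f hf
  have h1 := (Module.Flat.lTensor_preserves_injective_linearMap (M := F) f hf).comp
    (rTensor_inj_of_flat hi hg h N')
  have : (f.lTensor F) ∘ₗ (i.rTensor N') = (i.rTensor N) ∘ₗ (f.lTensor K) := by
    rw [LinearMap.lTensor_comp_rTensor, LinearMap.rTensor_comp_lTensor]
  refine Function.Injective.of_comp (f := i.rTensor N) ?_
  rw [← LinearMap.coe_comp, ← this]
  exact h1

lemma flat_of_inj {K F G : Type u} [AddCommGroup K] [Module R K] [AddCommGroup F] [Module R F]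
    [AddCommGroup G] [Module R G] {i : K →ₗ[R] F} {g : F →ₗ[R] G}
    (hg : Function.Surjective g) (h : Function.Exact i g) [Module.Flat R F]
    (H : ∀ (N : Type u) [AddCommGroup N] [Module R N], Function.Injective (i.rTensor N)) :
    Module.Flat R G := by
  rw [Module.Flat.iff_lTensor_preserves_injective_linearMap]
  intro N' N _ _ _ _ f hf
  rw [injective_iff_map_eq_zero]
  intro m hm
  obtain ⟨x, rfl⟩ := LinearMap.rTensor_surjective N' hg m
  let q := f.range.mkQ
  have hq : Function.Exact f q := LinearMap.exact_map_mkQ_range f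
  have hqs : Function.Surjective q := Submodule.mkQ_surjective _
  have c {A B C D : Type u} [AddCommGroup A] [Module R A] [AddCommGroup B] [Module R B]
    [AddCommGroup C] [Module R C] [AddCommGroup D] [Module R D] (a : A →ₗ[R] B) (b : C →ₗ[R] D) (x : A ⊗[R] C) :
     b.lTensor B (a.rTensor C x) = a.rTensor D (b.lTensor A x) := by
    rw [← LinearMap.comp_apply, LinearMap.lTensor_comp_rTensor, ← LinearMap.rTensor_comp_lTensor]; rfl
  rw [c] at hm
  obtain ⟨k, hk⟩ := (rTensor_exact N h hg _).1 hm
  have hk0 : q.lTensor K k = 0 := by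
    apply H (N ⧸ f.range)
    rw [← c, hk, map_zero]
    exact (lTensor_exact F hq hqs).apply_apply_eq_zero x
  obtain ⟨k', rfl⟩ := (lTensor_exact K hq hqs _).1 hk0
  rw [← c] at hk
  have := Module.Flat.lTensor_preserves_injective_linearMap (M := F) f hf hk
  rw [← this]
  exact (rTensor_exact N' h hg).apply_apply_eq_zero k'

lemma flat_prod {M N : Type u} [AddCommGroup M] [Module R M] [AddCommGroup N] [Module R N]
    [Module.Flat R M] [Module.Flat R N] : Module.Flat R (M × N) := by
  rw [Module.Flat.iff_lTensor_preserves_injective_linearMap]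
  intro L' L _ _ _ _ f hf
  rw [injective_iff_map_eq_zero]
  intro x hx
  have aux : ∀ {T : Type u} [AddCommGroup T] [Module R T] [Module.Flat R T] (a : M × N →ₗ[R] T),
      a.rTensor L' x = 0 := by
    intro T _ _ _ a
    apply Module.Flat.lTensor_preserves_injective_linearMap (M := T) f hf
    rw [← LinearMap.comp_apply, LinearMap.lTensor_comp_rTensor, ← LinearMap.rTensor_comp_lTensor,
      LinearMap.comp_apply, hx, map_zero, map_zero]
  have hid : x = ((LinearMap.inl R M N ∘ₗ LinearMap.fst R M N +
      LinearMap.inr R M N ∘ₗ LinearMap.snd R M N).rTensor L') x := by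
    have : LinearMap.inl R M N ∘ₗ LinearMap.fst R M N +
      LinearMap.inr R M N ∘ₗ LinearMap.snd R M N = LinearMap.id := by ext <;> simp
    rw [this, LinearMap.rTensor_id, LinearMap.id_apply]
  rw [hid, LinearMap.rTensor_add, LinearMap.rTensor_comp, LinearMap.rTensor_comp,
    LinearMap.add_apply, LinearMap.comp_apply, LinearMap.comp_apply, aux, aux, map_zero, map_zero,
    add_zero]

/-- E1 -/
lemma flat_iff_exact {X₂ X₁ X₀ K M : Type u} [AddCommGroup X₂] [Module R X₂]
    [AddCommGroup X₁] [Module R X₁] [AddCommGroup X₀] [Module R X₀] [AddCommGroup M] [Module R M]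
    [AddCommGroup K] [Module R K]
    (d₂ : X₂ →ₗ[R] X₁) (p : X₁ →ₗ[R] K) (i : K →ₗ[R] X₀) (e : X₀ →ₗ[R] M)
    (h₂ : Function.Exact d₂ p) (hp : Function.Surjective p) (hi : Function.Injective i)
    (h₁ : Function.Exact i e) (he : Function.Surjective e) [Module.Flat R X₀] :
    Module.Flat R M ↔ ∀ (N : Type u) [AddCommGroup N] [Module R N],
      Function.Exact (d₂.rTensor N) ((i ∘ₗ p).rTensor N) := by
  have hex := fun (N : Type u) [AddCommGroup N] [Module R N] => rTensor_exact N h₂ hp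
  have hsu := fun (N : Type u) [AddCommGroup N] [Module R N] => LinearMap.rTensor_surjective N hp
  constructor
  · intro hM N _ _ x
    rw [← hex N x, LinearMap.rTensor_comp, LinearMap.comp_apply]
    exact map_eq_zero_iff _ (rTensor_inj_of_flat hi he h₁ N)
  · intro H
    refine flat_of_inj he h₁ fun N _ _ => ?_
    rw [injective_iff_map_eq_zero]
    intro k hk
    obtain ⟨x, rfl⟩ := hsu N k
    rw [hex N x, ← H N x, LinearMap.rTensor_comp]
    exact hk

/-- E2 -/
lemma proj_iff_exact {X₂ X₁ X₀ K M : Type u} [AddCommGroup X₂] [Module R X₂]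
    [AddCommGroup X₁] [Module R X₁] [AddCommGroup X₀] [Module R X₀] [AddCommGroup M] [Module R M]
    [AddCommGroup K] [Module R K]
    (d₂ : X₂ →ₗ[R] X₁) (p : X₁ →ₗ[R] K) (i : K →ₗ[R] X₀) (e : X₀ →ₗ[R] M)
    (h₂ : Function.Exact d₂ p) (hp : Function.Surjective p) (hi : Function.Injective i)
    (h₁ : Function.Exact i e) (he : Function.Surjective e) [Module.Projective R X₀] :
    Module.Projective R M ↔ ∀ (N : Type u) [AddCommGroup N] [Module R N] (φ : X₁ →ₗ[R] N),
      φ ∘ₗ d₂ = 0 → ∃ ψ : X₀ →ₗ[R] N, ψ ∘ₗ (i ∘ₗ p) = φ := by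
  constructor
  · intro hM N _ _ φ hφ
    obtain ⟨s, hs⟩ := Module.projective_lifting_property e LinearMap.id he
    have hr : ∃ r : X₀ →ₗ[R] K, r ∘ₗ i = LinearMap.id := by
      exact ((h₁.split_tfae').out 0 1 rfl rfl).1 ⟨hi, s, hs⟩ |>.2
    obtain ⟨r, hr⟩ := hr
    -- descend φ to K
    let φ' : K →ₗ[R] N := (LinearMap.ker p).liftQ φ (by
      intro x hx
      obtain ⟨y, rfl⟩ := (h₂ x).1 hx
      exact LinearMap.congr_fun hφ y) ∘ₗ (p.quotKerEquivOfSurjective hp).symm.toLinearMap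
    refine ⟨φ' ∘ₗ r, ?_⟩
    ext x
    have : r (i (p x)) = p x := LinearMap.congr_fun hr _
    simp only [LinearMap.comp_apply, this, φ']
    have : (p.quotKerEquivOfSurjective hp).symm (p x) = (LinearMap.ker p).mkQ x := by
      rw [LinearEquiv.symm_apply_eq]; rfl
    simp [this]
  · intro H
    obtain ⟨r, hr⟩ := H K p (by ext x; exact h₂.apply_apply_eq_zero x)
    have hr : r ∘ₗ i = LinearMap.id := by
      ext k
      obtain ⟨x, rfl⟩ := hp k
      exact LinearMap.congr_fun hr x
    obtain ⟨_, s, hs⟩ := ((h₁.split_tfae').out 1 0 rfl rfl).1 ⟨he, r, hr⟩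
    exact Module.Projective.of_split s e hs

end elem

section dim
variable {R : Type u} [CommRing R]

/-- `M` has a `Q`-resolution of length `n`. -/
def HasQRes (Q : ∀ (M : Type u) [AddCommGroup M] [Module R M], Prop) :
    ℕ → ∀ (M : Type u) [AddCommGroup M] [Module R M], Prop
  | 0, M, _, _ => Q M
  | n + 1, M, _, _ => ∃ (K F : Type u) (_ : AddCommGroup K) (_ : Module R K)
      (_ : AddCommGroup F) (_ : Module R F) (i : K →ₗ[R] F) (g : F →ₗ[R] M),
      Function.Injective i ∧ Function.Surjective g ∧ Function.Exact i g ∧ Q F ∧ HasQRes Q n K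

/-- Closure properties. -/
structure GoodQ (Q : ∀ (M : Type u) [AddCommGroup M] [Module R M], Prop) : Prop where
  iso : ∀ (M N : Type u) [AddCommGroup M] [Module R M] [AddCommGroup N] [Module R N]
    (_ : M ≃ₗ[R] N), Q M → Q N
  prod : ∀ (M N : Type u) [AddCommGroup M] [Module R M] [AddCommGroup N] [Module R N],
    Q M → Q N → Q (M × N)
  ker : ∀ (K F G : Type u) [AddCommGroup K] [Module R K] [AddCommGroup F] [Module R F]
    [AddCommGroup G] [Module R G] (i : K →ₗ[R] F) (g : F →ₗ[R] G), Function.Injective i →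
    Function.Surjective g → Function.Exact i g → Q F → Q G → Q K
  proj : ∀ (M : Type u) [AddCommGroup M] [Module R M], Module.Projective R M → Q M

lemma exists_lift_inj {K F X : Type u} [AddCommGroup K] [Module R K] [AddCommGroup F] [Module R F]
    [AddCommGroup X] [Module R X] (i : K →ₗ[R] F) (hi : Function.Injective i) (φ : X →ₗ[R] F)
    (h : ∀ x, ∃ k, i k = φ x) : ∃ j : X →ₗ[R] K, ∀ x, i (j x) = φ x := by
  refine ⟨(LinearEquiv.ofInjective i hi).symm.toLinearMap ∘ₗ φ.codRestrict i.range h, fun x => ?_⟩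
  have := LinearEquiv.apply_symm_apply (LinearEquiv.ofInjective i hi) (φ.codRestrict i.range h x)
  exact congrArg Subtype.val this

variable {Q : ∀ (M : Type u) [AddCommGroup M] [Module R M], Prop}

lemma HasQRes.iso (hQ : GoodQ Q) {n : ℕ} {M N : Type u} [AddCommGroup M] [Module R M] [AddCommGroup N] [Module R N]
    (e : M ≃ₗ[R] N) (h : HasQRes Q n M) : HasQRes Q n N := by
  cases n with
  | zero => exact hQ.iso M N e h
  | succ n =>
    obtain ⟨K, F, _, _, _, _, i, g, hi, hg, hex, hF, hK⟩ := h
    refine ⟨K, F, _, _, _, _, i, e.toLinearMap ∘ₗ g, hi, e.surjective.comp hg, fun x => ?_, hF, hK⟩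
    rw [← hex x]; simp

lemma HasQRes.prod (hQ : GoodQ Q) {n : ℕ} {M P : Type u} [AddCommGroup M] [Module R M] [AddCommGroup P] [Module R P]
    (hP : Q P) (h : HasQRes Q n M) : HasQRes Q n (M × P) := by
  cases n with
  | zero => exact hQ.prod M P h hP
  | succ n =>
    obtain ⟨K, F, _, _, _, _, i, g, hi, hg, hex, hF, hK⟩ := h
    refine ⟨K, F × P, _, _, _, _, LinearMap.inl R F P ∘ₗ i, g.prodMap LinearMap.id,
      LinearMap.inl_injective.comp hi, ?_, ?_, hQ.prod F P hF hP, hK⟩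
    · rintro ⟨m, p⟩
      obtain ⟨x, rfl⟩ := hg m
      exact ⟨(x, p), rfl⟩
    · rintro ⟨x, p⟩
      constructor
      · intro h
        obtain ⟨h1, h2⟩ := Prod.mk.inj h
        obtain ⟨k, rfl⟩ := (hex x).1 h1
        exact ⟨k, Prod.ext rfl h2.symm⟩
      · rintro ⟨k, hk⟩
        obtain ⟨h1, h2⟩ := Prod.mk.inj hk
        exact Prod.ext ((hex x).2 ⟨k, h1⟩) h2.symm

lemma HasQRes.ker (hQ : GoodQ Q) {n : ℕ} {K' X G : Type u} [AddCommGroup K'] [Module R K'] [AddCommGroup X]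
    [Module R X] [AddCommGroup G] [Module R G] (i' : K' →ₗ[R] X) (f : X →ₗ[R] G)
    (hi' : Function.Injective i') (hf : Function.Surjective f) (hex' : Function.Exact i' f)
    (hG : Q G) (h : HasQRes Q n X) : HasQRes Q n K' := by
  cases n with
  | zero => exact hQ.ker K' X G i' f hi' hf hex' h hG
  | succ n =>
    obtain ⟨K, F, _, _, _, _, i, g, hi, hg, hex, hF, hK⟩ := h
    let F' := LinearMap.ker (f ∘ₗ g)
    have hF' : Q F' := hQ.ker F' F G F'.subtype (f ∘ₗ g) F'.injective_subtype (hf.comp hg)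
      (LinearMap.exact_subtype_ker_map _) hF hG
    obtain ⟨j, hj⟩ := exists_lift_inj i' hi' (g ∘ₗ F'.subtype) (fun x => (hex' _).1 x.2)
    obtain ⟨l, hl⟩ := exists_lift_inj F'.subtype F'.injective_subtype i (fun k => ⟨⟨i k, by
      simp [F', hex.apply_apply_eq_zero k]⟩, rfl⟩)
    refine ⟨K, F', _, _, _, _, l, j, ?_, ?_, ?_, hF', hK⟩
    · intro a b hab
      apply hi
      rw [← hl, ← hl, hab]
    · intro k
      obtain ⟨x, hx⟩ := hg (i' k)
      refine ⟨⟨x, by simp [F', hx, hex'.apply_apply_eq_zero k]⟩, hi' ?_⟩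
      rw [hj]; exact hx
    · intro x
      rw [← map_eq_zero_iff i' hi', hj]
      refine (hex (x : F)).trans ⟨?_, ?_⟩
      · rintro ⟨k, hk⟩
        exact ⟨k, Subtype.ext ((hl k).trans hk)⟩
      · rintro ⟨k, rfl⟩
        exact ⟨k, (hl k).symm⟩

lemma HasQRes.syz (hQ : GoodQ Q) {n : ℕ} {K' P M : Type u} [AddCommGroup K'] [Module R K'] [AddCommGroup P]
    [Module R P] [AddCommGroup M] [Module R M] (i' : K' →ₗ[R] P) (f : P →ₗ[R] M)
    (hi' : Function.Injective i') (hf : Function.Surjective f) (hex' : Function.Exact i' f)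
    (hP : Module.Projective R P) (h : HasQRes Q (n + 1) M) : HasQRes Q n K' := by
  obtain ⟨K, F, _, _, _, _, i, g, hi, hg, hex, hF, hK⟩ := h
  obtain ⟨s, hs⟩ := Module.projective_lifting_property g f hg
  replace hs : ∀ p, g (s p) = f p := fun p => LinearMap.congr_fun hs p
  obtain ⟨j, hj⟩ := exists_lift_inj i hi (s ∘ₗ i') (fun x => (hex _).1 (by
    rw [LinearMap.comp_apply, hs, hex'.apply_apply_eq_zero]))
  simp only [LinearMap.comp_apply] at hj
  refine HasQRes.ker hQ ((-j).prod i') (i.coprod s) ?_ ?_ ?_ hF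
    (HasQRes.prod hQ (hQ.proj P hP) hK)
  · intro a b hab
    exact hi' (Prod.mk.inj hab).2
  · intro y
    obtain ⟨p, hp⟩ := hf (g y)
    obtain ⟨k, hk⟩ := (hex (y - s p)).1 (by rw [map_sub, hs, hp, sub_self])
    exact ⟨(k, p), by simp [hk]⟩
  · rintro ⟨k, p⟩
    constructor
    · intro h
      simp only [LinearMap.coprod_apply] at h
      have hp : f p = 0 := by
        have := congrArg g h
        rwa [map_add, hex.apply_apply_eq_zero, zero_add, hs, map_zero] at this
      obtain ⟨k', rfl⟩ := (hex' p).1 hp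
      refine ⟨k', Prod.ext (hi ?_) rfl⟩
      change i (-(j k')) = i k
      rw [map_neg, hj]
      exact (eq_neg_of_add_eq_zero_left h).symm
    · rintro ⟨k', hk⟩
      obtain ⟨rfl, rfl⟩ := Prod.mk.inj hk
      simp [hj]

/-- Resolutions and syzygies. -/
lemma hasQRes_iff (hQ : GoodQ Q) (Z X : ℕ → Type u) [∀ n, AddCommGroup (Z n)] [∀ n, Module R (Z n)]
    [∀ n, AddCommGroup (X n)] [∀ n, Module R (X n)] (i : ∀ n, Z (n+1) →ₗ[R] X n)
    (e : ∀ n, X n →ₗ[R] Z n) (hi : ∀ n, Function.Injective (i n))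
    (he : ∀ n, Function.Surjective (e n)) (hex : ∀ n, Function.Exact (i n) (e n))
    (hX : ∀ n, Module.Projective R (X n)) (n k m : ℕ) (hm : m = k + n) : HasQRes Q n (Z k) ↔ Q (Z m) := by
  induction n generalizing k with
  | zero => subst hm; exact Iff.rfl
  | succ n ih =>
    rw [← ih (k+1) (by omega)]
    exact ⟨HasQRes.syz hQ (i k) (e k) (hi k) (he k) (hex k) (hX k), fun h =>
      ⟨_, _, _, _, _, _, i k, e k, hi k, he k, hex k, hQ.proj _ (hX k), h⟩⟩

lemma goodFlat : GoodQ (R := R) (fun M _ _ => Module.Flat R M) where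
  iso M N _ _ _ _ e h := Module.Flat.of_linearEquiv e.symm
  prod M N _ _ _ _ h h' := flat_prod
  ker K F G _ _ _ _ _ _ i g hi hg hex hF hG := flat_ker hi hg hex
  proj M _ _ h := inferInstance

lemma goodProj : GoodQ (R := R) (fun M _ _ => Module.Projective R M) where
  iso M N _ _ _ _ e h := Module.Projective.of_equiv e
  prod M N _ _ _ _ h h' := inferInstance
  ker K F G _ _ _ _ _ _ i g hi hg hex hF hG := by
    obtain ⟨s, hs⟩ := Module.projective_lifting_property g LinearMap.id hg
    obtain ⟨_, r, hr⟩ := ((hex.split_tfae').out 0 1 rfl rfl).1 ⟨hi, s, hs⟩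
    exact Module.Projective.of_split i r hr
  proj M _ _ h := h

end dim

section main

lemma dim_iff (R : Type u) [CommRing R] (M : Type u) [AddCommGroup M] [Module R M] (n : ℕ) :
    (fdLE R M n ↔ HasQRes (R := R) (fun M _ _ => Module.Flat R M) n M) ∧
    (pdLE R M n ↔ HasQRes (R := R) (fun M _ _ => Module.Projective R M) n M) := by
  obtain ⟨P⟩ := (inferInstance : HasProjectiveResolution (ModuleCat.of R M)).out
  let X : ℕ → Type u := fun n => P.complex.X n
  let d : ∀ n, X (n+1) →ₗ[R] X n := fun n => (P.complex.d (n+1) n).hom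
  have hd : ∀ n, Function.Exact (d (n+1)) (d n) := res_exact P
  have hX : ∀ n, Module.Projective R (X n) := res_proj P
  let Z : ℕ → Type u := fun n => X n ⧸ (d n).range
  let e : ∀ n, X n →ₗ[R] Z n := fun n => (d n).range.mkQ
  have he : ∀ n, Function.Surjective (e n) := fun n => Submodule.mkQ_surjective _
  have hde : ∀ n, Function.Exact (d n) (e n) := fun n => LinearMap.exact_map_mkQ_range _
  let i : ∀ n, Z (n+1) →ₗ[R] X n := fun n => (d (n+1)).range.liftQ (d n) (by
    rintro _ ⟨y, rfl⟩
    exact (hd n).apply_apply_eq_zero y)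
  have hie : ∀ n, i n ∘ₗ e (n+1) = d n := fun n => Submodule.liftQ_mkQ _ _ _
  have hi : ∀ n, Function.Injective (i n) := by
    intro n
    rw [injective_iff_map_eq_zero]
    intro z hz
    obtain ⟨x, rfl⟩ := he _ z
    have hz : d n x = 0 := by rw [← hie]; exact hz
    exact (hde (n+1) x).2 ((hd n x).1 hz)
  have hex : ∀ n, Function.Exact (i n) (e n) := by
    intro n x
    rw [hde n x]
    constructor
    · rintro ⟨y, rfl⟩
      exact ⟨e (n+1) y, LinearMap.congr_fun (hie n) y⟩
    · rintro ⟨z, rfl⟩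
      obtain ⟨y, rfl⟩ := he _ z
      exact ⟨y, (LinearMap.congr_fun (hie n) y).symm⟩
  obtain ⟨ε, hε, hdε⟩ := res_exact₀ P
  let E : Z 0 ≃ₗ[R] M := (Submodule.quotEquivOfEq _ _ hdε.linearMap_ker_eq.symm).trans
    (ε.quotKerEquivOfSurjective hε)
  have tr : ∀ {Q : ∀ (M : Type u) [AddCommGroup M] [Module R M], Prop}, GoodQ Q →
      (Q (Z n) ↔ HasQRes Q n M) := by
    intro Q hQ
    have := hasQRes_iff hQ Z X i e hi he hex hX n 0 n (by simp)
    rw [← this]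
    exact ⟨HasQRes.iso hQ E, HasQRes.iso hQ E.symm⟩
  constructor
  · rw [fd_bridge R M n P, ← tr goodFlat,
      flat_iff_exact (d (n+1)) (e (n+1)) (i n) (e n) (hde (n+1)) (he _) (hi n) (hex n) (he n), hie n]
  · rw [pd_bridge R M n P, ← tr goodProj,
      proj_iff_exact (d (n+1)) (e (n+1)) (i n) (e n) (hde (n+1)) (he _) (hi n) (hex n) (he n), hie n]

variable {A B : Type u} [CommRing A] [CommRing B] [Algebra A B] [Module.Flat A B]

lemma restrict_flatRes (n : ℕ) : ∀ (M : Type u) [AddCommGroup M] [Module B M] [Module A M]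
    [IsScalarTower A B M], HasQRes (R := B) (fun M _ _ => Module.Flat B M) n M →
      HasQRes (R := A) (fun M _ _ => Module.Flat A M) n M := by
  induction n with
  | zero =>
    intro M _ _ _ _ h
    have : Module.Flat B M := h
    exact Module.Flat.trans A B M
  | succ n ih =>
    rintro M _ _ _ _ ⟨K, F, _, _, _, _, i, g, hi, hg, hex, hF, hK⟩
    let _ : Module A K := Module.compHom K (algebraMap A B)
    have : IsScalarTower A B K := IsScalarTower.of_algebraMap_smul fun _ _ => rfl
    let _ : Module A F := Module.compHom F (algebraMap A B)
    have : IsScalarTower A B F := IsScalarTower.of_algebraMap_smul fun _ _ => rfl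
    exact ⟨K, F, _, _, _, _, i.restrictScalars A, g.restrictScalars A, hi, hg, hex,
      Module.Flat.trans A B F, ih K hK⟩

lemma baseChange_projRes (n : ℕ) : ∀ (M : Type u) [AddCommGroup M] [Module A M],
    HasQRes (R := A) (fun M _ _ => Module.Projective A M) n M →
      HasQRes (R := B) (fun M _ _ => Module.Projective B M) n (B ⊗[A] M) := by
  induction n with
  | zero =>
    intro M _ _ h
    have : Module.Projective A M := h
    exact (inferInstance : Module.Projective B (B ⊗[A] M))
  | succ n ih =>
    rintro M _ _ ⟨K, F, _, _, _, _, i, g, hi, hg, hex, hF, hK⟩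
    exact ⟨B ⊗[A] K, B ⊗[A] F, _, _, _, _, i.baseChange B, g.baseChange B,
      Module.Flat.lTensor_preserves_injective_linearMap i hi, LinearMap.lTensor_surjective B hg,
      lTensor_exact B hex hg, (inferInstance : Module.Projective B (B ⊗[A] F)), ih K hK⟩

end main

theorem strongNPerfect_localization
    (A : Type u) [CommRing A] (S : Submonoid A) (n : ℕ)
    (hA : IsStrongNPerfect A n) :
    IsStrongNPerfect (Localization S) n := by
  intro M _ _ hM
  let _ : Module A M := Module.compHom M (algebraMap A (Localization S))
  have : IsScalarTower A (Localization S) M := IsScalarTower.of_algebraMap_smul fun _ _ => rfl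
  have : Module.Flat A (Localization S) := IsLocalization.flat _ S
  have h1 := restrict_flatRes (A := A) n M ((dim_iff _ M n).1.1 hM)
  have h2 := (dim_iff A M n).2.1 (hA M ((dim_iff A M n).1.2 h1))
  have h3 := baseChange_projRes (B := Localization S) n M h2
  have hl := isLocalizedModule_id S M (Localization S)
  have hb := (isLocalizedModule_iff_isBaseChange S (Localization S) _).1 hl
  exact (dim_iff _ M n).2.2 (HasQRes.iso goodProj hb.equiv h3)
end
end

section
/- If A is a strong n-perfect commutative ring and I is a pure ideal of A (i.e., A/I is flat as an A-module), then A/I is a strong n-perfect ring. -/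
open CategoryTheory CategoryTheory.Limits

noncomputable section

universe u

open CategoryTheory CategoryTheory.Limits MonoidalCategory

/-- `Tor'` vanishing, computed on a projective resolution. -/
lemma isZero_tor'_iff {R : Type u} [CommRing R] {X : ModuleCat.{u} R}
    (P : ProjectiveResolution X) (N : ModuleCat.{u} R) (n : ℕ) :
    IsZero (((Tor' (ModuleCat.{u} R) (n + 1)).obj X).obj N) ↔
      ((P.complex.sc' (n + 2) (n + 1) n).map (tensorRight N)).Exact := by
  have e : ((Tor' (ModuleCat.{u} R) (n + 1)).obj X).obj N ≅
      (((tensorRight N).mapHomologicalComplex _).obj P.complex).homology (n + 1) :=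
    P.isoLeftDerivedObj ((tensoringRight (ModuleCat.{u} R)).obj N) (n + 1)
  rw [e.isZero_iff, ← HomologicalComplex.exactAt_iff_isZero_homology,
    HomologicalComplex.exactAt_iff' _ (n + 2) (n + 1) n (by simp) (by simp)]
  rfl

/-- `Ext` vanishing, computed on a projective resolution. -/
lemma isZero_ext_iff {R : Type u} [CommRing R] {X : ModuleCat.{u} R}
    (P : ProjectiveResolution X) (N : ModuleCat.{u} R) (n : ℕ) :
    IsZero (((Ext R (ModuleCat.{u} R) (n + 1)).obj (Opposite.op X)).obj N) ↔
      ∀ f : P.complex.X (n + 1) ⟶ N, P.complex.d (n + 2) (n + 1) ≫ f = 0 →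
        ∃ g : P.complex.X n ⟶ N, P.complex.d (n + 1) n ≫ g = f := by
  rw [(P.isoExt (R := R) (n + 1) N).isZero_iff, ← HomologicalComplex.exactAt_iff_isZero_homology,
    HomologicalComplex.exactAt_iff' _ n (n + 1) (n + 2) (by simp) (by simp),
    ShortComplex.moduleCat_exact_iff]
  rfl

lemma exists_smul_eq_of_pure {A : Type u} [CommRing A] (I : Ideal A) [I.Pure]
    {C : Type u} [AddCommGroup C] [Module A C] (x : C) (hx : x ∈ I • (⊤ : Submodule A C)) :
    ∃ e ∈ I, e • x = x := by
  induction hx using Submodule.smul_induction_on' with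
  | smul r hr m hm =>
    obtain ⟨y, hy, h⟩ := Ideal.exists_eq_mul_of_pure hr
    refine ⟨y, hy, ?_⟩
    rw [smul_smul, mul_comm, ← h]
  | add x hx y hy h1 h2 =>
    obtain ⟨a, ha, h1⟩ := h1
    obtain ⟨b, hb, h2⟩ := h2
    refine ⟨a + b - a * b, I.sub_mem (I.add_mem ha hb) (I.mul_mem_right _ ha), ?_⟩
    have h3 : (a * b) • x = b • x := by rw [mul_comm, mul_smul, h1]
    have h4 : (a * b) • y = a • y := by rw [mul_smul, h2]
    rw [smul_add, sub_smul, sub_smul, add_smul, add_smul, h1, h2, h3, h4]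
    abel

/-- If `a` kills `X`, then `a` kills `Tor'`: cycles multiplied by `a` are boundaries. -/
lemma smul_cycle_boundary {A : Type u} [CommRing A] {X : ModuleCat.{u} A}
    (P : ProjectiveResolution X) (N : ModuleCat.{u} A) (n : ℕ) (a : A) (ha : ∀ x : X, a • x = 0)
    (z : (P.complex.X (n + 1) ⊗ N : ModuleCat.{u} A))
    (hz : (P.complex.d (n + 1) n ▷ N) z = 0) :
    ∃ w : (P.complex.X (n + 2) ⊗ N : ModuleCat.{u} A),
      (P.complex.d (n + 2) (n + 1) ▷ N) w = a • z := by
  have haX : a • 𝟙 X = 0 := by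
    ext x
    exact ha x
  have hc : (a • 𝟙 P.complex) ≫ P.π = 0 := by
    have : (a • 𝟙 P.complex) ≫ P.π = P.π ≫ (ChainComplex.single₀ _).map (a • 𝟙 X) := by
      ext : 1
      simp only [HomologicalComplex.comp_f, HomologicalComplex.smul_f_apply,
        Linear.smul_comp, Category.id_comp]
      refine Eq.trans ?_ (congrArg (fun φ => P.π.f 0 ≫ φ)
        (ChainComplex.single₀_map_f_zero (a • 𝟙 X)).symm)
      refine Eq.trans ?_ (Linear.comp_smul _ _ _ (P.π.f 0) a (𝟙 X)).symm
      exact congrArg (a • ·) (Category.comp_id (P.π.f 0)).symm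
    rw [this, haX]
    simp
  have h := (ProjectiveResolution.liftHomotopyZero _ hc).comm (n + 1)
  rw [dNext_eq _ (show (ComplexShape.down ℕ).Rel (n+1) n by simp),
    prevD_eq _ (show (ComplexShape.down ℕ).Rel (n+2) (n+1) by simp)] at h
  generalize (ProjectiveResolution.liftHomotopyZero _ hc).hom n (n+1) = s at h
  generalize (ProjectiveResolution.liftHomotopyZero _ hc).hom (n+1) (n+2) = t at h
  have h' := congrArg (fun φ => (φ ▷ N) z) h
  refine ⟨(t ▷ N) z, ?_⟩
  have h1 : ((a • 𝟙 P.complex : P.complex ⟶ P.complex).f (n+1) ▷ N) z = a • z := by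
    simp
  simp only [h1] at h'
  rw [h']
  simp [hz]

section

variable {A : Type u} [CommRing A] (I : Ideal A)

abbrev extF : ModuleCat.{u} A ⥤ ModuleCat.{u} (A ⧸ I) :=
  ModuleCat.extendScalars.{u, u, u} (Ideal.Quotient.mk I)

abbrev resF : ModuleCat.{u} (A ⧸ I) ⥤ ModuleCat.{u} A :=
  ModuleCat.restrictScalars.{u, u, u} (Ideal.Quotient.mk I)

abbrev adjF : extF I ⊣ resF I :=
  ModuleCat.extendRestrictScalarsAdj.{u, u, u} (Ideal.Quotient.mk I)

instance : (resF I).Full where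
  map_surjective {X Y} f := by
    refine ⟨ModuleCat.ofHom
      { toFun := f.hom, map_add' := f.hom.map_add, map_smul' := ?_ }, rfl⟩
    intro r x
    obtain ⟨r, rfl⟩ := Ideal.Quotient.mk_surjective r
    exact f.hom.map_smul r x

/-- base change of the restriction is the original module -/
def extResIso (M : ModuleCat.{u} (A ⧸ I)) : (extF I).obj ((resF I).obj M) ≅ M :=
  asIso ((adjF I).counit.app M)

lemma extF_preservesHomology (h : Module.Flat A (A ⧸ I)) : (extF I).PreservesHomology := by
  have hf : (Ideal.Quotient.mk I).Flat := h
  have := ModuleCat.preservesFiniteLimits_extendScalars_of_flat hf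
  infer_instance

instance : (extF I).PreservesProjectiveObjects where
  projective_obj h := (adjF I).map_projective _ h

instance : (extF I).Additive := (adjF I).left_adjoint_additive

lemma extF_unit_surj (C : ModuleCat.{u} A) : Function.Surjective ((adjF I).unit.app C) := by
  intro x
  induction x using TensorProduct.induction_on with
  | zero => exact ⟨0, map_zero _⟩
  | tmul b c =>
    obtain ⟨b, rfl⟩ := Ideal.Quotient.mk_surjective b
    refine ⟨b • c, ?_⟩
    change (1 : A ⧸ I) ⊗ₜ[A] (b • c) = (Ideal.Quotient.mk I b) ⊗ₜ[A] c
    rw [← TensorProduct.smul_tmul]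
    congr 1
    rw [Algebra.smul_def, mul_one]
    rfl
  | add x y hx hy =>
    obtain ⟨x, rfl⟩ := hx
    obtain ⟨y, rfl⟩ := hy
    exact ⟨x + y, map_add _ _ _⟩

lemma extF_unit_ker (C : ModuleCat.{u} A) (x : C) (hx : (adjF I).unit.app C x = 0) :
    x ∈ I • (⊤ : Submodule A C) := by
  have h : (1 : A ⧸ I) ⊗ₜ[A] x = 0 := hx
  have h2 := TensorProduct.quotTensorEquivQuotSMul_mk_one_tmul I x
  rw [h, map_zero] at h2
  exact (Submodule.Quotient.mk_eq_zero _).1 h2.symm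

lemma exact_of_extF_exact (S : ShortComplex (ModuleCat.{u} A))
    (hS : (S.map (extF I)).Exact) (z : S.X₂) (hz : S.g z = 0) :
    ∃ w : S.X₁, z - S.f w ∈ I • (⊤ : Submodule A S.X₂) := by
  rw [ShortComplex.moduleCat_exact_iff] at hS
  have nat : ∀ {X Y : ModuleCat.{u} A} (f : X ⟶ Y) (x : X),
      (extF I).map f ((adjF I).unit.app X x) = (adjF I).unit.app Y (f x) := by
    intro X Y f x
    exact (congrArg (fun φ => φ.hom x) ((adjF I).unit.naturality f)).symm
  obtain ⟨w', hw'⟩ := hS ((adjF I).unit.app S.X₂ z) (by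
    refine (nat S.g z).trans ?_
    rw [hz, map_zero]
    rfl)
  obtain ⟨w, rfl⟩ := extF_unit_surj I _ w'
  refine ⟨w, extF_unit_ker I _ _ ?_⟩
  rw [map_sub, sub_eq_zero, ← hw']
  exact nat S.f w

lemma exact_of_pure [I.Pure] (S : ShortComplex (ModuleCat.{u} A)) (hS : (S.map (extF I)).Exact)
    (h : ∀ a ∈ I, ∀ z : S.X₂, S.g z = 0 → ∃ w : S.X₁, S.f w = a • z) : S.Exact := by
  rw [ShortComplex.moduleCat_exact_iff]
  intro z hz
  obtain ⟨w, hw⟩ := exact_of_extF_exact I _ hS z hz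
  obtain ⟨a, ha, haz⟩ := exists_smul_eq_of_pure I _ hw
  have hgf : S.g (S.f w) = 0 := congrArg (fun φ => φ.hom w) S.zero
  obtain ⟨w', hw'⟩ := h a ha (z - S.f w) (by rw [map_sub, hz, hgf, sub_zero])
  exact ⟨w' + w, by rw [map_add, hw', haz, sub_add_cancel]⟩

lemma ext_transfer {X Y Z : ModuleCat.{u} A} (N : ModuleCat.{u} (A ⧸ I)) (d : X ⟶ Y) (d' : Y ⟶ Z)
    (h : ∀ f : Y ⟶ (resF I).obj N, d ≫ f = 0 → ∃ g, d' ≫ g = f)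
    (f : (extF I).obj Y ⟶ N) (hf : (extF I).map d ≫ f = 0) :
    ∃ g, (extF I).map d' ≫ g = f := by
  obtain ⟨g, hg⟩ := h ((adjF I).homEquiv _ _ f) (by
    rw [← Adjunction.homEquiv_naturality_left, hf]
    simp [Adjunction.homEquiv_unit])
  refine ⟨((adjF I).homEquiv _ _).symm g, ?_⟩
  rw [← Adjunction.homEquiv_naturality_left_symm, hg, Equiv.symm_apply_apply]

end

theorem strongNPerfect_quotient_pure_ideal
    (A : Type u) [CommRing A] (I : Ideal A)
    (hpure : Module.Flat A (A ⧸ I)) (n : ℕ)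
    (hA : IsStrongNPerfect A n) :
    IsStrongNPerfect (A ⧸ I) n := by
  intro M _ _ hfd
  have := extF_preservesHomology I hpure
  have : I.Pure := hpure
  let MB : ModuleCat.{u} (A ⧸ I) := ModuleCat.of _ M
  let MA : ModuleCat.{u} A := (resF I).obj MB
  let P : ProjectiveResolution MA := projectiveResolution MA
  let Q := (extF I).mapProjectiveResolution P
  let e : (extF I).obj MA ≅ MB := extResIso I MB
  have hfdA : fdLE A MA n := by
    intro N
    refine (isZero_tor'_iff P N n).2 ?_
    have h1 := (isZero_tor'_iff Q ((extF I).obj N) n).1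
      ((hfd ((extF I).obj N)).of_iso (((Tor' _ (n + 1)).mapIso e).app _))
    have h2 : (((P.complex.sc' (n + 2) (n + 1) n).map (tensorRight N)).map (extF I)).Exact :=
      ShortComplex.exact_of_iso ((P.complex.sc' (n + 2) (n + 1) n).mapNatIso
        (Functor.Monoidal.commTensorRight (extF I) N)) h1
    refine exact_of_pure I _ h2 fun a ha z hz => ?_
    exact smul_cycle_boundary P N n a (fun x => by
      change (Ideal.Quotient.mk I a) • (show M from x) = 0
      rw [Ideal.Quotient.eq_zero_iff_mem.2 ha, zero_smul]) z hz
  have hpdA := hA MA hfdA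
  intro N
  refine IsZero.of_iso ?_ (((Ext _ _ (n + 1)).mapIso e.op).symm.app N).symm
  refine (isZero_ext_iff Q N n).2 fun f hf => ?_
  have hE := (isZero_ext_iff P ((resF I).obj N) n).1 (hpdA _)
  exact ext_transfer I N _ _ hE f hf
end
end

section
/- Let A ↪ B be an injective flat ring homomorphism of commutative rings, Q an ideal of A with QB = Q, and E an A-module such that E ⊗_A B is flat over B. Then pd_A(E) ≤ d if and only if pd_B(E ⊗_A B) ≤ d and pd_{A/Q}(E ⊗_A (A/Q)) ≤ d. -/
open CategoryTheory CategoryTheory.Limits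

noncomputable section

universe u

lemma ext_isZero_iff {R : Type u} [CommRing R] {X : ModuleCat.{u} R} (P : ProjectiveResolution X)
    (N : ModuleCat.{u} R) (n : ℕ) :
    IsZero (((Ext R (ModuleCat.{u} R) (n + 1)).obj (Opposite.op X)).obj N) ↔
     ∀ f : P.complex.X (n+1) ⟶ N, P.complex.d (n+2) (n+1) ≫ f = 0 →
       ∃ g : P.complex.X n ⟶ N, P.complex.d (n+1) n ≫ g = f := by
  rw [(P.isoExt (R := R) (n+1) N).isZero_iff, ← HomologicalComplex.exactAt_iff_isZero_homology,
    HomologicalComplex.exactAt_iff' _ n (n+1) (n+2) (by simp) (by simp),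
    ShortComplex.moduleCat_exact_iff]
  rfl

lemma abExt_sub_iff {R : Type u} [CommRing R] {X : ModuleCat.{u} R} (P : ProjectiveResolution X)
    (N : ModuleCat.{u} R) (n : ℕ) :
    Subsingleton (Abelian.Ext.{u} X N (n+1)) ↔
     ∀ f : P.complex.X (n+1) ⟶ N, P.complex.d (n+2) (n+1) ≫ f = 0 →
       ∃ g : P.complex.X n ⟶ N, P.complex.d (n+1) n ≫ g = f := by
  constructor
  · intro h f hf
    exact (P.extMk_eq_zero_iff f (n+2) rfl hf n rfl).1 (Subsingleton.elim _ _)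
  · intro h
    refine subsingleton_of_forall_eq 0 fun α => ?_
    obtain ⟨f, hf, rfl⟩ := P.extMk_surjective α (n+2) rfl
    exact (P.extMk_eq_zero_iff f (n+2) rfl hf n rfl).2 (h f hf)

lemma pdLE_iff (R : Type u) [CommRing R] (M : Type u) [AddCommGroup M] [Module R M] (n : ℕ) :
    pdLE R M n ↔ HasProjectiveDimensionLT (ModuleCat.of R M) (n+1) := by
  let P := ProjectiveResolution.of (ModuleCat.of R M)
  have : pdLE R M n ↔ ∀ N : ModuleCat.{u} R,
    Subsingleton (Abelian.Ext.{u} (ModuleCat.of R M) N (n+1)) :=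
    forall_congr' fun N => (ext_isZero_iff P N n).trans (abExt_sub_iff P N n).symm
  rw [this]
  exact ⟨hasProjectiveDimensionLT_of_enoughInjectives _ _, fun h N => 
    HasProjectiveDimensionLT.subsingleton _ (n+1) (n+1) le_rfl N⟩

lemma pdLE_zero_iff (R : Type u) [CommRing R] (M : Type u) [AddCommGroup M] [Module R M] :
    pdLE R M 0 ↔ Module.Projective R M := by
  rw [pdLE_iff, zero_add, ← projective_iff_hasProjectiveDimensionLT_one, 
    IsProjective.iff_projective]

lemma pdLE_succ_iff (R : Type u) [CommRing R] (K F M : Type u) [AddCommGroup M] [Module R M]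
   [AddCommGroup F] [Module R F] [AddCommGroup K] [Module R K] [Module.Projective R F]
   (i : K →ₗ[R] F) (p : F →ₗ[R] M) (hi : Function.Injective i) (hp : Function.Surjective p)
   (h : Function.Exact i p) (n : ℕ) : pdLE R M (n+1) ↔ pdLE R K n := by
  rw [pdLE_iff, pdLE_iff]
  let S : ShortComplex (ModuleCat.{u} R) := ShortComplex.mk (ModuleCat.ofHom i) (ModuleCat.ofHom p)
    (by ext x; simpa using h.apply_apply_eq_zero x)
  have hS : S.ShortExact :=
    { exact := by
        rw [ShortComplex.ShortExact.moduleCat_exact_iff_function_exact]; exact h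
      mono_f := (ModuleCat.mono_iff_injective _).2 hi
      epi_g := (ModuleCat.epi_iff_surjective _).2 hp }
  exact hS.hasProjectiveDimensionLT_X₃_iff n ((IsProjective.iff_projective F).1 inferInstance)

open TensorProduct

section helpers

/-- In a surjection of flat modules the kernel is flat. -/
lemma flat_of_exact {R : Type u} [CommRing R] {K F M : Type u} [AddCommGroup M] [Module R M]
    [AddCommGroup F] [Module R F] [AddCommGroup K] [Module R K] [Module.Flat R F] [Module.Flat R M]
    (i : K →ₗ[R] F) (p : F →ₗ[R] M) (hi : Function.Injective i) (hp : Function.Surjective p)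
    (h : Function.Exact i p) : Module.Flat R K := by
  rw [Module.Flat.iff_rTensor_preserves_injective_linearMap]
  intro N N' _ _ _ _ f hf
  have h1 : Function.Injective (i.lTensor N) :=
    LinearMap.lTensor_injective_of_exact_of_flat p hp i hi h N
  have h2 : Function.Injective (f.rTensor F) :=
    Module.Flat.rTensor_preserves_injective_linearMap f hf
  have h3 : (i.lTensor N') ∘ₗ (f.rTensor K) = (f.rTensor F) ∘ₗ (i.lTensor N) := by
    ext; simp
  have h4 : Function.Injective ((i.lTensor N') ∘ₗ (f.rTensor K)) := by
    rw [h3]; exact h2.comp h1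
  exact Function.Injective.of_comp (f := i.lTensor N') (by rwa [LinearMap.coe_comp] at h4)

variable {A B : Type u} [CommRing A] [CommRing B] [Algebra A B]

/-- `Q` is isomorphic to its extension to `B`. -/
lemma exists_equiv_map (hinj : Function.Injective (algebraMap A B)) (Q : Ideal A)
    (hQB : (Q.map (algebraMap A B) : Set B) = algebraMap A B '' Q) :
    ∃ e : Q ≃ₗ[A] (Q.map (algebraMap A B)), ∀ q : Q, (e q : B) = algebraMap A B q := by
  let f : Q →ₗ[A] (Q.map (algebraMap A B)) :=
    { toFun := fun q => ⟨algebraMap A B q, Ideal.mem_map_of_mem _ q.2⟩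
      map_add' := fun x y => by ext; simp
      map_smul' := fun a x => by ext; simp [Algebra.smul_def] }
  refine ⟨LinearEquiv.ofBijective f ⟨?_, ?_⟩, fun q => rfl⟩
  · intro x y hxy
    exact Subtype.ext (hinj (congrArg Subtype.val hxy))
  · rintro ⟨b, hb⟩
    have : b ∈ algebraMap A B '' Q := by rw [← hQB]; exact hb
    obtain ⟨q, hq, rfl⟩ := this
    exact ⟨⟨q, hq⟩, rfl⟩

/-- `Q ⊗ E → A ⊗ E` is injective. -/
lemma rTensor_Q_injective (hinj : Function.Injective (algebraMap A B)) (Q : Ideal A)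
    (hQB : (Q.map (algebraMap A B) : Set B) = algebraMap A B '' Q)
    (E : Type u) [AddCommGroup E] [Module A E] [Module.Flat B (B ⊗[A] E)] :
    Function.Injective (Q.subtype.rTensor E) := by
  obtain ⟨e, he⟩ := exists_equiv_map hinj Q hQB
  let Q' := Q.map (algebraMap A B)
  have h1 : Function.Injective (Q'.subtype.rTensor (B ⊗[A] E)) :=
    Module.Flat.rTensor_preserves_injective_linearMap _ Subtype.val_injective
  have h2 : Function.Injective ((Q'.subtype.restrictScalars A).rTensor E) := by
    have : ∀ x, (Q'.subtype.restrictScalars A).rTensor E x =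
        AlgebraTensorModule.cancelBaseChange A B B B E (Q'.subtype.rTensor (B ⊗[A] E)
          ((AlgebraTensorModule.cancelBaseChange A B B Q' E).symm x)) := by
      intro x
      induction x with
      | zero => simp
      | tmul x y => simp
      | add x y hx hy => simp only [map_add, hx, hy]
    intro x y hxy
    rw [this, this] at hxy
    exact (AlgebraTensorModule.cancelBaseChange A B B Q' E).symm.injective
      (h1 ((AlgebraTensorModule.cancelBaseChange A B B B E).injective hxy))
  have h3 : Function.Injective (e.toLinearMap.rTensor E) :=
    (LinearEquiv.rTensor E e).injective
  have h4 : ((Algebra.linearMap A B).rTensor E) ∘ₗ (Q.subtype.rTensor E) =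
      ((Q'.subtype.restrictScalars A).rTensor E) ∘ₗ (e.toLinearMap.rTensor E) := by
    ext x y
    simp [he, Q']
  have h5 : Function.Injective
      (((Algebra.linearMap A B).rTensor E) ∘ₗ (Q.subtype.rTensor E)) := by
    rw [h4]; exact h2.comp h3
  exact Function.Injective.of_comp (f := (Algebra.linearMap A B).rTensor E)
    (by rwa [LinearMap.coe_comp] at h5)

lemma tensor_swap {M N P P' : Type u} [AddCommGroup M] [Module A M] [AddCommGroup N] [Module A N]
    [AddCommGroup P] [Module A P] [AddCommGroup P'] [Module A P'] (f : M →ₗ[A] N) (g : P →ₗ[A] P')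
    (x : M ⊗[A] P) : f.rTensor P' (g.lTensor M x) = g.lTensor N (f.rTensor P x) := by
  rw [← LinearMap.comp_apply, ← LinearMap.comp_apply, LinearMap.rTensor_comp_lTensor,
    LinearMap.lTensor_comp_rTensor]

/-- Tensoring with `A ⧸ Q` preserves injectivity when `Q ⊗ E → A ⊗ E` is injective. -/
lemma lTensor_quot_injective (Q : Ideal A) {K F E : Type u}
    [AddCommGroup E] [Module A E] [AddCommGroup F] [Module A F] [AddCommGroup K] [Module A K]
    (hE : Function.Injective (Q.subtype.rTensor E))
    (i : K →ₗ[A] F) (p : F →ₗ[A] E) (hi : Function.Injective i) (hp : Function.Surjective p)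
    (h : Function.Exact i p) : Function.Injective (i.lTensor (A ⧸ Q)) := by
  rw [injective_iff_map_eq_zero]
  intro z hz
  have hQ : Function.Exact Q.subtype Q.mkQ := LinearMap.exact_subtype_mkQ Q
  have hQs : Function.Surjective Q.mkQ := Submodule.mkQ_surjective Q
  obtain ⟨y, rfl⟩ := LinearMap.rTensor_surjective K hQs z
  have h1 : Q.mkQ.rTensor F (i.lTensor A y) = 0 := by
    rw [← hz]
    exact tensor_swap Q.mkQ i y
  obtain ⟨t, ht⟩ := (rTensor_exact F hQ hQs _).1 h1
  have h2 : p.lTensor Q t = 0 := by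
    apply hE
    rw [map_zero]
    have : Q.subtype.rTensor E (p.lTensor Q t) = p.lTensor A (Q.subtype.rTensor F t) :=
      tensor_swap Q.subtype p t
    rw [this, ht]
    exact (lTensor_exact A h hp).apply_apply_eq_zero y
  obtain ⟨s, rfl⟩ := (lTensor_exact Q h hp _).1 h2
  have h3 : Q.subtype.rTensor K s = y := by
    apply Module.Flat.lTensor_preserves_injective_linearMap (M := A) i hi
    rw [← ht]
    exact (tensor_swap Q.subtype i s).symm
  rw [← h3]
  exact (rTensor_exact K hQ hQs).apply_apply_eq_zero s

/-- Extension of maps into `S`-modules. -/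
lemma extend_of_projective (S : Type u) [CommRing S] [Algebra A S] {K F E : Type u}
    [AddCommGroup E] [Module A E] [AddCommGroup F] [Module A F] [AddCommGroup K] [Module A K]
    [Module.Projective S (S ⊗[A] E)]
    (i : K →ₗ[A] F) (p : F →ₗ[A] E) (hp : Function.Surjective p)
    (h : Function.Exact i p) (hinj : Function.Injective (i.lTensor S)) :
    ∃ r : S ⊗[A] F →ₗ[S] S ⊗[A] K, r ∘ₗ i.baseChange S = LinearMap.id := by
  have hex : Function.Exact (i.baseChange S) (p.baseChange S) := lTensor_exact S h hp
  have hs : Function.Surjective (p.baseChange S) := LinearMap.lTensor_surjective S hp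
  have hi : Function.Injective (i.baseChange S) := hinj
  exact ((hex.split_tfae hi hs).out 0 1).1
    (Module.projective_lifting_property (p.baseChange S) LinearMap.id hs)

lemma extend_map (S : Type u) [CommRing S] [Algebra A S] {K F M : Type u}
    [AddCommGroup F] [Module A F] [AddCommGroup K] [Module A K]
    [AddCommGroup M] [Module A M] [Module S M] [IsScalarTower A S M]
    (i : K →ₗ[A] F) 
    (hr : ∃ r : S ⊗[A] F →ₗ[S] S ⊗[A] K, r ∘ₗ i.baseChange S = LinearMap.id)
    (f : K →ₗ[A] M) : ∃ g : F →ₗ[A] M, g ∘ₗ i = f := by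
  obtain ⟨r, hr⟩ := hr
  let f' : S ⊗[A] K →ₗ[S] M := AlgebraTensorModule.lift
    ((LinearMap.lsmul S (K →ₗ[A] M)).flip f)
  refine ⟨((f' ∘ₗ r).restrictScalars A) ∘ₗ (TensorProduct.mk A S F 1), ?_⟩
  ext x
  have := LinearMap.congr_fun hr ((1 : S) ⊗ₜ x)
  simp only [LinearMap.comp_apply, LinearMap.baseChange_tmul, LinearMap.id_apply] at this
  simp [this, f']

end helpers
section zero

variable {A : Type u} [CommRing A]

lemma extend_torsion (Q : Ideal A) {K F E N : Type u}
    [AddCommGroup E] [Module A E] [AddCommGroup F] [Module A F] [AddCommGroup K] [Module A K]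
    [AddCommGroup N] [Module A N]
    (hE : Function.Injective (Q.subtype.rTensor E))
    [Module.Projective (A ⧸ Q) ((A ⧸ Q) ⊗[A] E)]
    (i : K →ₗ[A] F) (p : F →ₗ[A] E) (hi : Function.Injective i) (hp : Function.Surjective p)
    (h : Function.Exact i p) (hN : ∀ q ∈ Q, ∀ n : N, q • n = 0) (f : K →ₗ[A] N) :
    ∃ g : F →ₗ[A] N, g ∘ₗ i = f := by
  have hT : Module.IsTorsionBySet A N Q := fun n q => hN q q.2 n
  let _ : Module (A ⧸ Q) N := hT.module
  have _ : IsScalarTower A (A ⧸ Q) N := hT.isScalarTower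
  exact extend_map (A ⧸ Q) i
    (extend_of_projective (A ⧸ Q) i p hp h (lTensor_quot_injective Q hE i p hi hp h)) f

lemma exists_cover (E : Type u) [AddCommGroup E] [Module A E] :
    ∃ p : (E →₀ A) →ₗ[A] E, Function.Surjective p :=
  ⟨Finsupp.linearCombination A id, fun x => ⟨Finsupp.single x 1, by simp⟩⟩

lemma exists_resolution (E : Type u) [AddCommGroup E] [Module A E] :
    ∃ (K : Type u) (_ : AddCommGroup K) (_ : Module A K) (i : K →ₗ[A] (E →₀ A))
      (p : (E →₀ A) →ₗ[A] E), Function.Injective i ∧ Function.Surjective p ∧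
        Function.Exact i p := by
  obtain ⟨p, hp⟩ := exists_cover (A := A) E
  exact ⟨LinearMap.ker p, inferInstance, inferInstance, (LinearMap.ker p).subtype, p,
    Subtype.val_injective, hp, LinearMap.exact_subtype_ker_map p⟩

lemma lift_of_torsion_ker (Q : Ideal A) {K N' N : Type u}
    [AddCommGroup K] [Module A K] [AddCommGroup N] [Module A N] [AddCommGroup N'] [Module A N']
    (hK : Function.Injective (Q.subtype.rTensor K))
    [Module.Projective (A ⧸ Q) ((A ⧸ Q) ⊗[A] K)]
    (m : N' →ₗ[A] N) (hm : ∀ q ∈ Q, ∀ n : N', m n = 0 → q • n = 0)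
    (f : K →ₗ[A] N) (hf : ∀ x, f x ∈ LinearMap.range m) :
    ∃ g : K →ₗ[A] N', m ∘ₗ g = f := by
  obtain ⟨p, hp⟩ := exists_cover (A := A) K
  let i := (LinearMap.ker p).subtype
  have hex : Function.Exact i p := LinearMap.exact_subtype_ker_map p
  obtain ⟨h, hh⟩ := Module.projective_lifting_property m.rangeRestrict
    ((f.codRestrict _ hf) ∘ₗ p) m.surjective_rangeRestrict
  have hh' : ∀ x, m (h x) = f (p x) := fun x =>
    congrArg Subtype.val (LinearMap.congr_fun hh x)
  let l : LinearMap.ker p →ₗ[A] LinearMap.ker m :=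
    (h ∘ₗ i).codRestrict _ (fun x => by
      rw [LinearMap.mem_ker, LinearMap.comp_apply, hh', hex.apply_apply_eq_zero, map_zero])
  obtain ⟨l', hl'⟩ := extend_torsion (K := LinearMap.ker p) (N := LinearMap.ker m) Q hK i p Subtype.val_injective hp hex
    (fun q hq n => Subtype.ext (hm q hq n n.2)) l
  have hl : ∀ x, (l' (i x) : N') = h (i x) := fun x =>
    congrArg Subtype.val (LinearMap.congr_fun hl' x)
  let k : (K →₀ A) →ₗ[A] N' := h - (LinearMap.ker m).subtype ∘ₗ l'
  have hk : LinearMap.ker p ≤ LinearMap.ker k := by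
    intro x hx
    have := hl ⟨x, hx⟩
    simp only [i, Submodule.subtype_apply] at this
    simp [k, this]
  have hmk : ∀ x, m (k x) = f (p x) := by
    intro x
    have := (l' x).2
    rw [LinearMap.mem_ker] at this
    simp [k, hh', this]
  refine ⟨(Submodule.liftQ _ k hk) ∘ₗ (p.quotKerEquivOfSurjective hp).symm.toLinearMap, ?_⟩
  ext x
  obtain ⟨y, rfl⟩ := hp x
  have : (p.quotKerEquivOfSurjective hp).symm (p y) = Submodule.Quotient.mk y := by
    rw [LinearEquiv.symm_apply_eq]; rfl
  simp only [LinearMap.comp_apply, LinearEquiv.coe_coe, this]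
  exact hmk y

variable {B : Type u} [CommRing B] [Algebra A B] 

lemma projective_of_retract {R : Type u} [CommRing R] {K F : Type u} [AddCommGroup K] [Module R K]
    [AddCommGroup F] [Module R F] [Module.Projective R F] (i : K →ₗ[R] F)
    (h : ∃ r : F →ₗ[R] K, r ∘ₗ i = LinearMap.id) : Module.Projective R K := by
  obtain ⟨r, hr⟩ := h
  exact Module.Projective.of_split i r hr

lemma projective_descent [Module.Flat A B] (hinj : Function.Injective (algebraMap A B)) (Q : Ideal A)
    (hQB : (Q.map (algebraMap A B) : Set B) = algebraMap A B '' Q)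
    (E : Type u) [AddCommGroup E] [Module A E]
    [Module.Projective B (B ⊗[A] E)] [Module.Projective (A ⧸ Q) ((A ⧸ Q) ⊗[A] E)] :
    Module.Projective A E := by
  obtain ⟨K, _, _, i, p, hi, hp, hex⟩ := exists_resolution (A := A) E
  have hE := rTensor_Q_injective hinj Q hQB E
  have hrB := extend_of_projective B i p hp hex
    (Module.Flat.lTensor_preserves_injective_linearMap i hi)
  have hrQ := extend_of_projective (A ⧸ Q) i p hp hex (lTensor_quot_injective Q hE i p hi hp hex)
  have : Module.Projective B (B ⊗[A] K) := projective_of_retract _ hrB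
  have : Module.Projective (A ⧸ Q) ((A ⧸ Q) ⊗[A] K) := projective_of_retract _ hrQ
  have hK := rTensor_Q_injective hinj Q hQB K
  -- the multiplication map
  let m : Q ⊗[A] K →ₗ[A] K := (TensorProduct.lid A K).toLinearMap ∘ₗ Q.subtype.rTensor K
  have hm1 : ∀ (q : Q) (t : Q ⊗[A] K), (q : A) • t = q ⊗ₜ m t := by
    intro q t
    induction t with
    | zero => simp
    | tmul x y =>
      simp only [m, LinearMap.comp_apply, LinearMap.rTensor_tmul, LinearEquiv.coe_coe,
        TensorProduct.lid_tmul, Submodule.subtype_apply]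
      rw [← TensorProduct.smul_tmul, TensorProduct.smul_tmul']
      congr 1
      ext
      simp [mul_comm]
    | add x y hx hy => rw [smul_add, hx, hy, map_add, TensorProduct.tmul_add]
  have hm : ∀ q ∈ Q, ∀ t, m t = 0 → q • t = 0 := fun q hq t ht => by
    have := hm1 ⟨q, hq⟩ t
    rw [ht, TensorProduct.tmul_zero] at this
    exact this
  have hmr : ∀ q ∈ Q, ∀ x : K, q • x ∈ LinearMap.range m := fun q hq x =>
    ⟨(⟨q, hq⟩ : Q) ⊗ₜ x, by simp [m]⟩
  let N₀ := LinearMap.range m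
  obtain ⟨g₀, hg₀⟩ := extend_torsion Q (N := K ⧸ N₀) hE i p hi hp hex (by
    intro q hq n
    obtain ⟨x, rfl⟩ := Submodule.mkQ_surjective _ n
    rw [← map_smul, Submodule.mkQ_apply, Submodule.Quotient.mk_eq_zero]
    exact hmr q hq x) N₀.mkQ
  obtain ⟨g, hg⟩ := Module.projective_lifting_property N₀.mkQ g₀ N₀.mkQ_surjective
  obtain ⟨f₁, hf₁⟩ := lift_of_torsion_ker Q hK m hm (LinearMap.id - g ∘ₗ i) (by
    intro x
    change _ ∈ N₀
    rw [← Submodule.Quotient.mk_eq_zero, ← Submodule.mkQ_apply]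
    have h1 := LinearMap.congr_fun hg (i x)
    have h2 := LinearMap.congr_fun hg₀ x
    simp only [LinearMap.comp_apply] at h1 h2
    simp only [LinearMap.sub_apply, LinearMap.id_apply, LinearMap.comp_apply, map_sub, h1, h2,
      sub_self])
  obtain ⟨e, -⟩ := exists_equiv_map hinj Q hQB
  let e' : Q ⊗[A] K ≃ₗ[A] (Q.map (algebraMap A B)) ⊗[A] K := LinearEquiv.rTensor K e
  obtain ⟨G, hG⟩ := extend_map B i hrB (e'.toLinearMap ∘ₗ f₁)
  have hret : (m ∘ₗ e'.symm.toLinearMap ∘ₗ G + g) ∘ₗ i = LinearMap.id := by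
    ext1 x
    have h1 := LinearMap.congr_fun hG x
    have h2 := LinearMap.congr_fun hf₁ x
    simp only [LinearMap.comp_apply, LinearMap.sub_apply, LinearMap.id_apply,
      LinearEquiv.coe_coe] at h1 h2
    simp only [LinearMap.comp_apply, LinearMap.add_apply, LinearEquiv.coe_coe, h1,
      LinearEquiv.symm_apply_apply, h2, LinearMap.id_apply, sub_add_cancel]
  have hsp : ∃ s, p ∘ₗ s = LinearMap.id := by
    have htf := ((hex.split_tfae hi hp).out 0 1 rfl rfl)
    exact htf.2 (Exists.intro _ hret)
  obtain ⟨s, hs⟩ := hsp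
  exact Module.Projective.of_split s p hs

end zero

open TensorProduct in
theorem pdLE_iff_of_flat_tensor
    (A B : Type u) [CommRing A] [CommRing B] [Algebra A B]
    (hinj : Function.Injective (algebraMap A B)) [Module.Flat A B]
    (Q : Ideal A)
    (hQB : (Q.map (algebraMap A B) : Set B) = algebraMap A B '' Q)
    (E : Type u) [AddCommGroup E] [Module A E]
    [Module.Flat B (B ⊗[A] E)] (d : ℕ) :
    pdLE A E d ↔ pdLE B (B ⊗[A] E) d ∧ pdLE (A ⧸ Q) ((A ⧸ Q) ⊗[A] E) d := by
  induction d generalizing E with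
  | zero =>
    rw [pdLE_zero_iff, pdLE_zero_iff, pdLE_zero_iff]
    constructor
    · intro h
      exact ⟨inferInstance, inferInstance⟩
    · rintro ⟨h1, h2⟩
      exact projective_descent hinj Q hQB E
  | succ d ih =>
    obtain ⟨K, _, _, i, p, hi, hp, hex⟩ := exists_resolution (A := A) E
    have hE := rTensor_Q_injective hinj Q hQB E
    have hiB : Function.Injective (i.baseChange B) :=
      Module.Flat.lTensor_preserves_injective_linearMap i hi
    have hiQ : Function.Injective (i.baseChange (A ⧸ Q)) :=
      lTensor_quot_injective Q hE i p hi hp hex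
    have hexB : Function.Exact (i.baseChange B) (p.baseChange B) := lTensor_exact B hex hp
    have hexQ : Function.Exact (i.baseChange (A ⧸ Q)) (p.baseChange (A ⧸ Q)) :=
      lTensor_exact (A ⧸ Q) hex hp
    have hpB : Function.Surjective (p.baseChange B) := LinearMap.lTensor_surjective B hp
    have hpQ : Function.Surjective (p.baseChange (A ⧸ Q)) :=
      LinearMap.lTensor_surjective (A ⧸ Q) hp
    have : Module.Flat B (B ⊗[A] K) :=
      flat_of_exact (i.baseChange B) (p.baseChange B) hiB hpB hexB
    rw [pdLE_succ_iff A K _ E i p hi hp hex d, pdLE_succ_iff B _ _ _ _ _ hiB hpB hexB d,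
      pdLE_succ_iff (A ⧸ Q) _ _ _ _ _ hiQ hpQ hexQ d]
    exact ih K
end
end

section
/- Let A ↪ B be an injective flat ring homomorphism of commutative rings and Q a pure ideal of A with QB = Q. For any A-module E, fd_A(E) ≤ d if and only if fd_B(E ⊗_A B) ≤ d and fd_{A/Q}(E ⊗_A (A/Q)) ≤ d. -/
open CategoryTheory CategoryTheory.Limits

noncomputable section

universe u

open TensorProduct

lemma tor_iff_exact {R : Type u} [CommRing R] (M : ModuleCat.{u} R) (P : ProjectiveResolution M)
    (N : ModuleCat.{u} R) (n : ℕ) :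
    IsZero (((Tor' (ModuleCat.{u} R) (n + 1)).obj M).obj N) ↔
    Function.Exact ((P.complex.d (n+2) (n+1)).hom.rTensor N)
      ((P.complex.d (n+1) n).hom.rTensor N) := by
  rw [Tor'_obj_obj, (P.isoLeftDerivedObj _ (n+1)).isZero_iff]
  change IsZero (HomologicalComplex.homology _ (n+1)) ↔ _
  rw [← HomologicalComplex.exactAt_iff_isZero_homology,
    HomologicalComplex.exactAt_iff' _ (n + 2) (n + 1) n (by simp only [ChainComplex.prev]; rfl)
    (by simp), ShortComplex.ShortExact.moduleCat_exact_iff_function_exact]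
  rfl

lemma exact_baseChange_iff {R S : Type u} [CommRing R] [CommRing S] [Algebra R S]
    {X Y Z : Type u} [AddCommGroup X] [AddCommGroup Y] [AddCommGroup Z]
    [Module R X] [Module R Y] [Module R Z] (f : X →ₗ[R] Y) (g : Y →ₗ[R] Z)
    (N : Type u) [AddCommGroup N] [Module R N] [Module S N] [IsScalarTower R S N] :
    Function.Exact ((f.baseChange S).rTensor N) ((g.baseChange S).rTensor N) ↔
    Function.Exact (f.rTensor N) (g.rTensor N) := by
  let e (X : Type u) [AddCommGroup X] [Module R X] : (S ⊗[R] X) ⊗[S] N ≃+ X ⊗[R] N :=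
    ((TensorProduct.comm S (S ⊗[R] X) N).toAddEquiv.trans
      (AlgebraTensorModule.cancelBaseChange R S S N X).toAddEquiv).trans
      (TensorProduct.comm R N X).toAddEquiv
  have he : ∀ {X Y : Type u} [AddCommGroup X] [AddCommGroup Y] [Module R X] [Module R Y]
      (f : X →ₗ[R] Y) (t), f.rTensor N (e X t) = e Y ((f.baseChange S).rTensor N t) := by
    intro X Y _ _ _ _ f t
    induction t with
    | zero => simp
    | add a b ha hb => simp only [map_add, ha, hb]
    | tmul a b =>
      induction a with
      | zero => simp
      | add a c ha hb => simp only [map_add, ha, hb, add_tmul]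
      | tmul s x => simp [e]
  refine Function.Exact.iff_of_ladder_addEquiv (e₁ := e X) (e₂ := e Y) (e₃ := e Z)
    (f₁₂ := ((f.baseChange S).rTensor N).toAddMonoidHom)
    (f₂₃ := ((g.baseChange S).rTensor N).toAddMonoidHom)
    (g₁₂ := (f.rTensor N).toAddMonoidHom) (g₂₃ := (g.rTensor N).toAddMonoidHom)
    ?_ ?_ |>.symm
  · ext t; exact he f t
  · ext t; exact he g t

lemma tor_baseChange_aux {R S : Type u} [CommRing R] [CommRing S] (f : R →+* S)
    (alg : Algebra R S) (halg : alg = f.toAlgebra) [Module.Flat R S]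
    (M : Type u) [AddCommGroup M] [Module R M] (P : ProjectiveResolution (ModuleCat.of R M))
    (N : Type u) [AddCommGroup N] [Module S N] (n : ℕ) :
    IsZero (((Tor' (ModuleCat.{u} S) (n + 1)).obj (ModuleCat.of S (S ⊗[R] M))).obj
      (ModuleCat.of S N)) ↔
    Function.Exact (((P.complex.d (n+2) (n+1)).hom.baseChange S).rTensor N)
      (((P.complex.d (n+1) n).hom.baseChange S).rTensor N) := by
  subst halg
  let F := ModuleCat.extendScalars.{u,u,u} f
  have hf : f.Flat := ‹_›
  have : PreservesFiniteLimits F := ModuleCat.preservesFiniteLimits_extendScalars_of_flat hf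
  have : F.IsLeftAdjoint := (ModuleCat.extendRestrictScalarsAdj f).isLeftAdjoint
  have : PreservesFiniteColimits F := inferInstance
  have : F.Additive := Functor.additive_of_preserves_binary_products F
  have : F.PreservesHomology := inferInstance
  have : F.PreservesProjectiveObjects :=
    ⟨fun hX => (ModuleCat.extendRestrictScalarsAdj f).map_projective _ hX⟩
  exact tor_iff_exact _ (F.mapProjectiveResolution P) (ModuleCat.of S N) n

lemma tor_baseChange {R S : Type u} [CommRing R] [CommRing S] [alg : Algebra R S]
    [Module.Flat R S]
    (M : Type u) [AddCommGroup M] [Module R M] (P : ProjectiveResolution (ModuleCat.of R M))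
    (N : Type u) [AddCommGroup N] [Module R N] [Module S N] [IsScalarTower R S N] (n : ℕ) :
    IsZero (((Tor' (ModuleCat.{u} S) (n + 1)).obj (ModuleCat.of S (S ⊗[R] M))).obj
      (ModuleCat.of S N)) ↔
    Function.Exact ((P.complex.d (n+2) (n+1)).hom.rTensor N)
      ((P.complex.d (n+1) n).hom.rTensor N) := by
  rw [← exact_baseChange_iff (S := S)]
  exact tor_baseChange_aux (algebraMap R S) alg
    (Algebra.algebra_ext _ _ fun r => rfl) M P N n

/-- half-exactness of Tor in the middle -/
lemma exact_middle {A : Type u} [CommRing A] {X Y Z : Type u}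
    [AddCommGroup X] [AddCommGroup Y] [AddCommGroup Z]
    [Module A X] [Module A Y] [Module A Z] [Module.Flat A Z] (f : X →ₗ[A] Y) (g : Y →ₗ[A] Z)
    (hgf : g ∘ₗ f = 0)
    {K N L : Type u} [AddCommGroup K] [AddCommGroup N] [AddCommGroup L]
    [Module A K] [Module A N] [Module A L] (i : K →ₗ[A] N) (p : N →ₗ[A] L)
    (hi : Function.Injective i) (hp : Function.Surjective p) (hip : Function.Exact i p)
    (hK : Function.Exact (f.rTensor K) (g.rTensor K))
    (hL : Function.Exact (f.rTensor L) (g.rTensor L)) :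
    Function.Exact (f.rTensor N) (g.rTensor N) := by
  have comm : ∀ {U V : Type u} [AddCommGroup U] [AddCommGroup V] [Module A U] [Module A V]
      {C D : Type u} [AddCommGroup C] [AddCommGroup D] [Module A C] [Module A D]
      (h : U →ₗ[A] V) (q : C →ₗ[A] D) (t : U ⊗[A] C),
      h.rTensor D (q.lTensor U t) = q.lTensor V (h.rTensor C t) := by
    intro U V _ _ _ _ C D _ _ _ _ h q t
    rw [← LinearMap.comp_apply, ← LinearMap.comp_apply, LinearMap.rTensor_comp_lTensor,
      LinearMap.lTensor_comp_rTensor]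
  intro y
  constructor
  · intro hy
    have h1 : g.rTensor L (p.lTensor Y y) = 0 := by rw [comm, hy, map_zero]
    obtain ⟨x', hx'⟩ := (hL _).1 h1
    obtain ⟨x, rfl⟩ := LinearMap.lTensor_surjective X hp x'
    have h2 : p.lTensor Y (y - f.rTensor N x) = 0 := by
      rw [map_sub, ← comm, hx', sub_self]
    obtain ⟨k, hk⟩ := (lTensor_exact Y hip hp _).1 h2
    have h3 : g.rTensor K k = 0 := by
      apply Module.Flat.lTensor_preserves_injective_linearMap (M := Z) i hi
      rw [← comm, hk, map_sub, hy, map_zero, ← LinearMap.comp_apply, ← LinearMap.rTensor_comp,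
        hgf]
      simp
    obtain ⟨w, rfl⟩ := (hK _).1 h3
    refine ⟨i.lTensor X w + x, ?_⟩
    rw [map_add, comm, hk]; abel
  · rintro ⟨x, rfl⟩
    rw [← LinearMap.comp_apply, ← LinearMap.rTensor_comp, hgf]
    simp

open TensorProduct in
theorem fdLE_iff_of_pure_ideal
    (A B : Type u) [CommRing A] [CommRing B] [Algebra A B]
    (hinj : Function.Injective (algebraMap A B)) [Module.Flat A B]
    (Q : Ideal A) (hpure : Module.Flat A (A ⧸ Q))
    (hQB : (Q.map (algebraMap A B) : Set B) = algebraMap A B '' Q)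
    (E : Type u) [AddCommGroup E] [Module A E] (d : ℕ) :
    fdLE A E d ↔ fdLE B (B ⊗[A] E) d ∧ fdLE (A ⧸ Q) ((A ⧸ Q) ⊗[A] E) d := by
  let P : ProjectiveResolution (ModuleCat.of A E) := ProjectiveResolution.of _
  have hA : ∀ (N : Type u) [AddCommGroup N] [Module A N], _ :=
    fun N _ _ => tor_iff_exact _ P (ModuleCat.of A N) d
  constructor
  · intro h
    constructor
    · intro N
      let : Module A N := Module.compHom N (algebraMap A B)
      have : IsScalarTower A B N := ⟨fun a b n => by
        rw [Algebra.smul_def, mul_smul]; rfl⟩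
      exact (tor_baseChange E P N d).2 ((hA N).1 (h _))
    · intro N
      let : Module A N := Module.compHom N (algebraMap A (A ⧸ Q))
      have : IsScalarTower A (A ⧸ Q) N := ⟨fun a b n => by
        rw [Algebra.smul_def, mul_smul]; rfl⟩
      exact (tor_baseChange E P N d).2 ((hA N).1 (h _))
  · rintro ⟨hB, hQ⟩ N
    let J : Ideal B := Q.map (algebraMap A B)
    -- Q ≃ J as A-modules
    let e : Q ≃ₗ[A] J := LinearEquiv.ofBijective
      ((Algebra.linearMap A B).restrict (p := Q) (q := J.restrictScalars A)
        (fun x hx => Ideal.mem_map_of_mem _ hx)) (by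
        constructor
        · intro x y hxy
          exact Subtype.ext (hinj (congrArg Subtype.val hxy))
        · rintro ⟨y, hy⟩
          have : y ∈ (J : Set B) := hy
          rw [hQB] at this
          obtain ⟨x, hx, rfl⟩ := this
          exact ⟨⟨x, hx⟩, rfl⟩)
    -- `0 → J ⊗ N → N → (A/Q) ⊗ N → 0`
    let i : J ⊗[A] N →ₗ[A] N :=
      (TensorProduct.lid A N).toLinearMap ∘ₗ (Q.subtype.rTensor N) ∘ₗ
        (e.symm.toLinearMap.rTensor N)
    let p : N →ₗ[A] (A ⧸ Q) ⊗[A] N := (Q.mkQ.rTensor N) ∘ₗ (TensorProduct.lid A N).symm.toLinearMap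
    have hQmk : Function.Exact Q.subtype Q.mkQ := LinearMap.exact_subtype_mkQ Q
    have hmk : Function.Surjective Q.mkQ := Submodule.mkQ_surjective Q
    have hex := rTensor_exact N hQmk hmk
    have hi0 : Function.Injective (Q.subtype.rTensor N) := by
      rw [← LinearMap.lTensor_inj_iff_rTensor_inj]
      exact LinearMap.lTensor_injective_of_exact_of_flat Q.mkQ hmk Q.subtype
        Q.injective_subtype hQmk N
    refine (hA N).2 ?_
    have : Projective (P.complex.X d) := P.projective d
    have : Module.Projective A (P.complex.X d) := (IsProjective.iff_projective _).2 ‹_›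
    refine exact_middle (P.complex.d (d+2) (d+1)).hom (P.complex.d (d+1) d).hom ?_ i p ?_ ?_ ?_
      ((tor_baseChange (S := B) E P (J ⊗[A] N) d).1 (hB _))
      ((tor_baseChange (S := A ⧸ Q) E P ((A ⧸ Q) ⊗[A] N) d).1 (hQ _))
    · rw [← ModuleCat.hom_comp, P.complex.d_comp_d]; rfl
    · have h3 : Function.Injective (e.symm.toLinearMap.rTensor N) :=
        (e.symm.rTensor N).injective
      exact (TensorProduct.lid A N).injective.comp (hi0.comp h3)
    · exact (LinearMap.rTensor_surjective N hmk).comp (TensorProduct.lid A N).symm.surjective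
    · intro n
      constructor
      · intro hn
        obtain ⟨t, ht⟩ := (hex ((TensorProduct.lid A N).symm n)).1 hn
        refine ⟨e.rTensor N t, ?_⟩
        have h4 : e.symm.toLinearMap.rTensor N (e.rTensor N t) = t :=
          (e.rTensor N).symm_apply_apply t
        change TensorProduct.lid A N (Q.subtype.rTensor N
          (e.symm.toLinearMap.rTensor N (e.rTensor N t))) = n
        rw [h4, ht, LinearEquiv.apply_symm_apply]
      · rintro ⟨t, rfl⟩
        change Q.mkQ.rTensor N ((TensorProduct.lid A N).symm (TensorProduct.lid A N
          (Q.subtype.rTensor N (e.symm.toLinearMap.rTensor N t)))) = 0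
        rw [LinearEquiv.symm_apply_apply]
        exact (hex _).2 ⟨_, rfl⟩
end
end

section
/- A commutative ring R is both a (1,d)-ring and a strong d-perfect ring if and only if R is a (0,d)-ring (that is, gldim(R) ≤ d). -/
open CategoryTheory CategoryTheory.Limits

noncomputable section

universe u

/-- `Tor_1(K, L) = 0`, expressed through presentations of `L` by flat modules. -/
def TorZ (R : Type u) [CommRing R] (K L : Type u) [AddCommGroup K] [Module R K]
    [AddCommGroup L] [Module R L] : Prop :=
  ∀ (L' Q : Type u) [AddCommGroup L'] [Module R L'] [AddCommGroup Q] [Module R Q]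
    (g : L' →ₗ[R] Q) (f : Q →ₗ[R] L), Function.Injective g → Function.Exact g f →
    Function.Surjective f → Module.Flat R Q → Function.Injective (g.lTensor K)

section
variable {R : Type u} [CommRing R]
variable {K' P K L' Q L : Type u} [AddCommGroup K'] [Module R K'] [AddCommGroup P] [Module R P]
  [AddCommGroup K] [Module R K] [AddCommGroup L'] [Module R L'] [AddCommGroup Q] [Module R Q]
  [AddCommGroup L] [Module R L]

lemma torZ_of_rTensor (g : K' →ₗ[R] P) (f : P →ₗ[R] K)
    (hgf : Function.Exact g f) (hf : Function.Surjective f) [Module.Flat R P]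
    (h : Function.Injective (g.rTensor L)) : TorZ R K L := by
  intro L' Q _ _ _ _ a b ha hab hb _
  rw [injective_iff_map_eq_zero]
  intro x hx
  obtain ⟨y, rfl⟩ := LinearMap.rTensor_surjective L' hf x
  have e1 : f.rTensor Q (a.lTensor P y) = 0 := by
    rw [← hx, ← LinearMap.comp_apply, ← LinearMap.comp_apply,
      LinearMap.rTensor_comp_lTensor, LinearMap.lTensor_comp_rTensor]
  obtain ⟨z, hz⟩ := (rTensor_exact Q hgf hf _).1 e1
  have e2 : g.rTensor L (b.lTensor K' z) = 0 := by
    have : g.rTensor L (b.lTensor K' z) = b.lTensor P (g.rTensor Q z) := by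
      rw [← LinearMap.comp_apply, ← LinearMap.comp_apply,
        LinearMap.rTensor_comp_lTensor, LinearMap.lTensor_comp_rTensor]
    rw [this, hz]
    exact (lTensor_exact P hab hb _).2 ⟨y, rfl⟩
  have e3 : b.lTensor K' z = 0 := h (by rw [e2, map_zero])
  obtain ⟨w, hw⟩ := (lTensor_exact K' hab hb _).1 e3
  have e4 : g.rTensor L' w = y := by
    apply Module.Flat.lTensor_preserves_injective_linearMap (M := P) a ha
    rw [← hz, ← hw, ← LinearMap.comp_apply, ← LinearMap.comp_apply,
        LinearMap.rTensor_comp_lTensor, LinearMap.lTensor_comp_rTensor]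
  rw [← e4]
  exact (rTensor_exact L' hgf hf _).2 ⟨w, rfl⟩

lemma TorZ.symm (h : TorZ R K L) : TorZ R L K := by
  let f := Finsupp.linearCombination R (id : L → L)
  have hf : Function.Surjective f := Finsupp.linearCombination_id_surjective R L
  have hx : Function.Exact (LinearMap.ker f).subtype f := LinearMap.exact_subtype_ker_map f
  refine torZ_of_rTensor (K' := LinearMap.ker f) (LinearMap.ker f).subtype f hx hf ?_
  rw [← LinearMap.lTensor_inj_iff_rTensor_inj]
  exact h _ _ _ f (Submodule.subtype_injective _) hx hf inferInstance

lemma TorZ.shift (g : K' →ₗ[R] P) (f : P →ₗ[R] K) (hg : Function.Injective g)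
    (hgf : Function.Exact g f) (hf : Function.Surjective f) [Module.Flat R P]
    (a : L' →ₗ[R] Q) (b : Q →ₗ[R] L) (ha : Function.Injective a)
    (hab : Function.Exact a b) (hb : Function.Surjective b) [Module.Flat R Q]
    (h : TorZ R K L') : TorZ R K' L := by
  have h1 : Function.Injective (g.lTensor L') := h.symm _ _ g f hg hgf hf inferInstance
  have h2 : Function.Injective (a.rTensor P) :=
    Module.Flat.rTensor_preserves_injective_linearMap (M := P) a ha
  have h3 : Function.Injective (a.rTensor K') := by
    have : Function.Injective (g.lTensor Q ∘ₗ a.rTensor K') := by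
      rw [LinearMap.lTensor_comp_rTensor, ← LinearMap.rTensor_comp_lTensor]
      exact h2.comp h1
    exact Function.Injective.of_comp this
  exact (torZ_of_rTensor a b hab hb h3).symm

lemma TorZ.of_flat_left [Module.Flat R K] : TorZ R K L := by
  intro L' Q _ _ _ _ a b ha hab hb _
  exact Module.Flat.lTensor_preserves_injective_linearMap a ha

lemma TorZ.of_equiv (e : L ≃ₗ[R] Q) (h : TorZ R K L) : TorZ R K Q := by
  intro L' Q _ _ _ _ a b ha hab hb _
  refine h _ _ a (e.symm.toLinearMap ∘ₗ b) ha ?_ (e.symm.surjective.comp hb) inferInstance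
  intro x
  simpa using hab x

end

section
variable {R : Type u} [CommRing R] (C : ChainComplex (ModuleCat.{u} R) ℕ)

/-- The `i`-th syzygy of a complex, as a cokernel. -/
abbrev Syz (i : ℕ) : Type u := C.X i ⧸ LinearMap.range (C.d (i + 1) i).hom

/-- The map induced by the differential on a syzygy. -/
def syzMap (i : ℕ) : Syz C (i + 1) →ₗ[R] C.X i :=
  Submodule.liftQ _ (C.d (i + 1) i).hom (by
    rintro _ ⟨x, rfl⟩
    rw [LinearMap.mem_ker, ← LinearMap.comp_apply, ← ModuleCat.hom_comp, C.d_comp_d]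
    rfl)

lemma syzMap_mk (i : ℕ) (x : C.X (i + 1)) :
    syzMap C i (Submodule.Quotient.mk x) = (C.d (i + 1) i).hom x := rfl

lemma syzMap_exact (i : ℕ) :
    Function.Exact (syzMap C i) (LinearMap.range (C.d (i + 1) i).hom).mkQ := by
  intro x
  rw [Submodule.mkQ_apply, Submodule.Quotient.mk_eq_zero]
  constructor
  · rintro ⟨y, rfl⟩; exact ⟨Submodule.Quotient.mk y, rfl⟩
  · rintro ⟨y, rfl⟩
    obtain ⟨y, rfl⟩ := Submodule.Quotient.mk_surjective _ y
    exact ⟨y, rfl⟩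

lemma syzMap_injective (hC : ∀ n, (ShortComplex.mk _ _ (C.d_comp_d (n + 2) (n + 1) n)).Exact)
    (i : ℕ) : Function.Injective (syzMap C i) := by
  rw [injective_iff_map_eq_zero]
  intro y hy
  obtain ⟨y, rfl⟩ := Submodule.Quotient.mk_surjective _ y
  rw [Submodule.Quotient.mk_eq_zero]
  exact (ShortComplex.moduleCat_exact_iff _).1 (hC i) y hy

lemma torZ_syz (D : ChainComplex (ModuleCat.{u} R) ℕ)
    (hC : ∀ n, (ShortComplex.mk _ _ (C.d_comp_d (n + 2) (n + 1) n)).Exact)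
    (hD : ∀ n, (ShortComplex.mk _ _ (D.d_comp_d (n + 2) (n + 1) n)).Exact)
    (fC : ∀ n, Module.Flat R (C.X n)) (fD : ∀ n, Module.Flat R (D.X n)) (j : ℕ) :
    ∀ i, TorZ R (Syz C i) (Syz D j) → TorZ R (Syz C (i + j)) (Syz D 0) := by
  induction j with
  | zero => intro i h; exact h
  | succ j ih =>
    intro i h
    have := ih (i + 1) (TorZ.shift (syzMap C i) (Submodule.mkQ _) (syzMap_injective C hC i)
      (syzMap_exact C i) (Submodule.mkQ_surjective _) (syzMap D j) (Submodule.mkQ _)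
      (syzMap_injective D hD j) (syzMap_exact D j) (Submodule.mkQ_surjective _) h)
    rwa [show i + (j + 1) = i + 1 + j by omega]

variable {C} {M : ModuleCat.{u} R} (P : ProjectiveResolution M)

lemma res_projective (n : ℕ) : Module.Projective R (P.complex.X n) :=
  (IsProjective.iff_projective _).2 (P.projective n)

lemma res_flat (n : ℕ) : Module.Flat R (P.complex.X n) :=
  have := res_projective P n
  inferInstance

lemma syz_projective (d : ℕ) (h : pdLE R M d) : Module.Projective R (Syz P.complex d) := by
  let N := ModuleCat.of R (Syz P.complex (d + 1))
  have h1 := (h N).of_iso (P.isoExt (R := R) (d + 1) N).symm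
  rw [← HomologicalComplex.exactAt_iff_isZero_homology,
    HomologicalComplex.exactAt_iff' _ d (d + 1) (d + 2) (by simp) (by simp),
    ShortComplex.moduleCat_exact_iff] at h1
  let c : P.complex.X (d + 1) ⟶ N := ModuleCat.ofHom (Submodule.mkQ _)
  obtain ⟨k, hk⟩ := h1 c (by
    change P.complex.d (d + 2) (d + 1) ≫ c = 0
    ext x
    exact (Submodule.Quotient.mk_eq_zero _).2 ⟨x, rfl⟩)
  change P.complex.X d ⟶ N at k
  change P.complex.d (d + 1) d ≫ k = c at hk
  have hk' : ∀ x, k.hom ((P.complex.d (d + 1) d).hom x) = Submodule.Quotient.mk x := fun x =>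
    congrArg (fun t => t.hom x) hk
  have := res_projective P d
  let s : Syz P.complex d →ₗ[R] P.complex.X d :=
    Submodule.liftQ _ (LinearMap.id - syzMap P.complex d ∘ₗ k.hom) (by
      rintro _ ⟨x, rfl⟩
      rw [LinearMap.mem_ker, LinearMap.sub_apply, LinearMap.comp_apply, hk', syzMap_mk]
      exact sub_self _)
  refine Module.Projective.of_split s (Submodule.mkQ _) ?_
  ext x
  change Submodule.mkQ _ (x - syzMap P.complex d (k.hom x)) = Submodule.mkQ _ x
  rw [map_sub, (syzMap_exact P.complex d _).2 ⟨_, rfl⟩, sub_zero]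

/-- The zeroth syzygy is the resolved module. -/
def syzZeroEquiv : Syz P.complex 0 ≃ₗ[R] M :=
  let i : (ModuleCat.of R (Syz P.complex 0)) ≅ M :=
    (ModuleCat.cokernelIsColimit (P.complex.d 1 0)).coconePointUniqueUpToIso
      P.isColimitCokernelCofork
  i.toLinearEquiv

lemma fd_of_flat_syz (d : ℕ) (h : Module.Flat R (Syz P.complex d)) : fdLE R M d := by
  intro N
  refine IsZero.of_iso ?_ (P.isoLeftDerivedObj ((MonoidalCategory.tensoringRight _).obj N) (d + 1))
  change IsZero (HomologicalComplex.homology _ _)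
  rw [← HomologicalComplex.exactAt_iff_isZero_homology,
    HomologicalComplex.exactAt_iff' _ (d + 2) (d + 1) d (by simp) (by simp),
    ShortComplex.moduleCat_exact_iff]
  have := res_flat P d
  have hT : TorZ R N (Syz P.complex d) := (TorZ.of_flat_left (R := R)).symm
  have hi : Function.Injective ((syzMap P.complex d).rTensor N) := by
    rw [← LinearMap.lTensor_inj_iff_rTensor_inj]
    exact hT _ _ _ (Submodule.mkQ _) (syzMap_injective _ P.exact_succ d)
      (syzMap_exact _ d) (Submodule.mkQ_surjective _) inferInstance
  intro x hx
  change TensorProduct R (P.complex.X (d + 1)) N at x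
  change ((P.complex.d (d + 1) d).hom.rTensor N) x = 0 at hx
  change ∃ y, ((P.complex.d (d + 2) (d + 1)).hom.rTensor N) y = x
  refine (rTensor_exact N (LinearMap.exact_map_mkQ_range _) (Submodule.mkQ_surjective _) x).1 ?_
  apply hi
  rw [map_zero, ← LinearMap.comp_apply, ← LinearMap.rTensor_comp]
  exact hx

end

theorem oneD_ring_and_strongDPerfect_iff_zeroD_ring
    (R : Type u) [CommRing R] (d : ℕ) :
    ((∀ (M : Type u) [AddCommGroup M] [Module R M],
        Module.FinitePresentation R M → pdLE R M d) ∧ IsStrongNPerfect R d) ↔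
    (∀ (M : Type u) [AddCommGroup M] [Module R M], pdLE R M d) := by
  refine ⟨fun ⟨h1, h2⟩ M _ _ => h2 M ?_, fun h => ⟨fun M _ _ _ => h M, fun M _ _ _ => h M⟩⟩
  let P := ProjectiveResolution.of (ModuleCat.of R M)
  refine fd_of_flat_syz P d ?_
  rw [Module.Flat.iff_lTensor_injective]
  intro I hI
  let Q := ProjectiveResolution.of (ModuleCat.of R (R ⧸ I))
  have hfp : Module.FinitePresentation R (R ⧸ I) :=
    Module.finitePresentation_of_surjective I.mkQ (Submodule.mkQ_surjective _) (by rw [Submodule.ker_mkQ]; exact hI)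
  have hp := syz_projective Q d (h1 (R ⧸ I) hfp)
  have hT := torZ_syz P.complex Q.complex P.exact_succ Q.exact_succ (res_flat P) (res_flat Q) d 0
    (TorZ.of_flat_left (R := R)).symm
  rw [zero_add] at hT
  exact (hT.of_equiv (syzZeroEquiv Q)) _ _ I.subtype I.mkQ (Submodule.subtype_injective _)
    (LinearMap.exact_subtype_mkQ I) (Submodule.mkQ_surjective _) inferInstance
end
end

section
/- A semihereditary commutative ring is hereditary if and only if it is strong 1-perfect. -/
open CategoryTheory CategoryTheory.Limits

noncomputable section

universe u

theorem flat_submodule {R : Type u} [CommRing R]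
    (hsemi : ∀ I : Ideal R, I.FG → Module.Projective R I) {P : Type u} [AddCommGroup P] [Module R P]
    [Module.Flat R P] (K : Submodule R P) : Module.Flat R K := by
  rw [Module.Flat.iff_rTensor_injective]
  intro J hJ
  have := hsemi J hJ
  have h1 := Module.Flat.lTensor_preserves_injective_linearMap (M := J) K.subtype K.subtype_injective
  have h2 := Module.Flat.rTensor_preserves_injective_linearMap (M := P) J.subtype J.subtype_injective
  have h3 := h2.comp h1
  have h4 : (J.subtype.rTensor P) ∘ (K.subtype.lTensor J) = (K.subtype.lTensor R) ∘ (J.subtype.rTensor K) := by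
    rw [← LinearMap.coe_comp, ← LinearMap.coe_comp, LinearMap.rTensor_comp_lTensor, LinearMap.lTensor_comp_rTensor]
  rw [h4] at h3
  exact Function.Injective.of_comp h3

theorem pure_of_flat {R : Type u} [CommRing R] {L A K N : Type u} [AddCommGroup L] [Module R L]
    [AddCommGroup A] [Module R A] [AddCommGroup K] [Module R K] [AddCommGroup N] [Module R N]
    (i : L →ₗ[R] A) (q : A →ₗ[R] K) (hi : Function.Injective i) (hiq : Function.Exact i q)
    (hq : Function.Surjective q) [Module.Flat R K] : Function.Injective (i.rTensor N) := by
  rw [injective_iff_map_eq_zero]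
  intro x hx
  obtain ⟨F, _, _, _, p, hp⟩ : ∃ (F : Type u) (_ : AddCommGroup F) (_ : Module R F)
      (_ : Module.Flat R F) (p : F →ₗ[R] N), Function.Surjective p :=
    ⟨N →₀ R, inferInstance, inferInstance, inferInstance, Finsupp.linearCombination R id,
      Finsupp.linearCombination_id_surjective R N⟩
  let g : LinearMap.ker p →ₗ[R] F := (LinearMap.ker p).subtype
  have hgp : Function.Exact g p := LinearMap.exact_subtype_ker_map p
  obtain ⟨y, rfl⟩ := LinearMap.lTensor_surjective L hp x
  have hz : p.lTensor A (i.rTensor _ y) = 0 := by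
    rw [← hx, ← LinearMap.comp_apply, ← LinearMap.comp_apply, LinearMap.rTensor_comp_lTensor, LinearMap.lTensor_comp_rTensor]
  obtain ⟨w, hw⟩ := (lTensor_exact A hgp hp _).1 hz
  have hw0 : q.rTensor _ w = 0 := by
    apply Module.Flat.lTensor_preserves_injective_linearMap (M := K) g (Submodule.subtype_injective _)
    rw [map_zero, ← LinearMap.comp_apply, LinearMap.lTensor_comp_rTensor, ← LinearMap.rTensor_comp_lTensor, LinearMap.comp_apply, hw, ← LinearMap.comp_apply, ← LinearMap.rTensor_comp, hiq.linearMap_comp_eq_zero]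
    simp
  obtain ⟨v, rfl⟩ := (rTensor_exact _ hiq hq _).1 hw0
  have : y = g.lTensor L v := by
    apply Module.Flat.rTensor_preserves_injective_linearMap (M := F) i hi
    rw [← hw, ← LinearMap.comp_apply, ← LinearMap.comp_apply, LinearMap.rTensor_comp_lTensor, LinearMap.lTensor_comp_rTensor]
  rw [this]
  exact (lTensor_exact L hgp hp).apply_apply_eq_zero v

/-- Exactness of the tensored complex when the image of `d1` is flat. -/
theorem tensor_exact_of_flat {R : Type u} [CommRing R] {A B C D N : Type u} [AddCommGroup A] [Module R A]
    [AddCommGroup B] [Module R B] [AddCommGroup C] [Module R C] [AddCommGroup D] [Module R D]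
    [AddCommGroup N] [Module R N]
    (d3 : A →ₗ[R] B) (d2 : B →ₗ[R] C) (d1 : C →ₗ[R] D) (h32 : Function.Exact d3 d2)
    (h21 : Function.Exact d2 d1) [Module.Flat R (LinearMap.range d1)] :
    Function.Exact (d3.rTensor N) (d2.rTensor N) := by
  have hinj : Function.Injective ((LinearMap.range d2).subtype.rTensor N) := by
    apply pure_of_flat _ d1.rangeRestrict (Submodule.subtype_injective _) _ d1.surjective_rangeRestrict
    intro x
    rw [← LinearMap.mem_ker, LinearMap.ker_rangeRestrict, LinearMap.mem_ker, h21 x]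
    simp
  have hex : Function.Exact d3 d2.rangeRestrict := by
    intro x
    rw [← h32 x, ← LinearMap.mem_ker, LinearMap.ker_rangeRestrict, LinearMap.mem_ker]
  have h := rTensor_exact N hex d2.surjective_rangeRestrict
  intro x
  rw [← h x]
  have : d2.rTensor N x = (LinearMap.range d2).subtype.rTensor N (d2.rangeRestrict.rTensor N x) := by
    rw [← LinearMap.comp_apply, ← LinearMap.rTensor_comp]; rfl
  rw [this, map_eq_zero_iff _ hinj]

theorem projective_submodule {R : Type u} [CommRing R]
    (h : ∀ I : Ideal R, Module.Projective R I) {P : Type u} [AddCommGroup P] [Module R P]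
    [Module.Projective R P] (K : Submodule R P) : Module.Projective R K := by
  apply Module.Projective.of_lifting_property''
  intro f hf
  -- embed the free module in an injective module
  let N : ModuleCat.{u} R := ModuleCat.of R (K →₀ R)
  let E := Injective.under N
  have hE : Module.Injective R E := Module.injective_iff_injective_object .. |>.2 (inferInstance : Injective (Injective.under N))
  let j : (K →₀ R) →ₗ[R] E := (Injective.ι N).hom
  have hj : Function.Injective j := (ModuleCat.mono_iff_injective _).1 inferInstance
  let W := (LinearMap.ker f).map j
  have hQ : Module.Baer R (E ⧸ W) := by
    intro I g
    have := h I
    obtain ⟨g1, hg1⟩ := Module.projective_lifting_property W.mkQ g W.mkQ_surjective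
    obtain ⟨g2, hg2⟩ := hE.out I.subtype I.subtype_injective g1
    refine ⟨W.mkQ ∘ₗ g2, fun x hx => ?_⟩
    have := hg2 ⟨x, hx⟩
    simp only [Submodule.subtype_apply] at this
    rw [LinearMap.comp_apply, this, ← hg1]; rfl
  let fK : K →ₗ[R] E ⧸ W := ((LinearMap.ker f).mapQ W j (Submodule.le_comap_map _ _)) ∘ₗ
    (f.quotKerEquivOfSurjective hf).symm.toLinearMap
  have hfK : ∀ y, fK (f y) = W.mkQ (j y) := by
    intro y
    have : (f.quotKerEquivOfSurjective hf).symm (f y) = (LinearMap.ker f).mkQ y := by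
      rw [LinearEquiv.symm_apply_eq]; rfl
    simp [fK, this]
  obtain ⟨a, ha⟩ := hQ.extension_property K.subtype K.subtype_injective fK
  obtain ⟨b, hb⟩ := Module.projective_lifting_property W.mkQ a W.mkQ_surjective
  have hab : ∀ k : K, W.mkQ (b k) = fK k := fun k => by
    rw [← ha, ← hb]; rfl
  have hr : ∀ k : K, (b ∘ₗ K.subtype) k ∈ LinearMap.range j := by
    intro k
    obtain ⟨y, rfl⟩ := hf k
    have h1 := hab (f y)
    rw [hfK, ← sub_eq_zero, ← map_sub, Submodule.mkQ_apply, Submodule.Quotient.mk_eq_zero] at h1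
    obtain ⟨z, -, hz⟩ := h1
    exact ⟨z + y, by rw [map_add, hz]; simp⟩
  let e := LinearEquiv.ofInjective j hj
  refine ⟨e.symm.toLinearMap ∘ₗ (b ∘ₗ K.subtype).codRestrict _ hr, ?_⟩
  ext1 k
  obtain ⟨y, hy⟩ := hr k
  have hk : e.symm (((b ∘ₗ K.subtype).codRestrict _ hr) k) = y := by
    rw [LinearEquiv.symm_apply_eq]; ext; exact hy.symm
  simp only [LinearMap.comp_apply, LinearEquiv.coe_coe, hk, LinearMap.id_apply]
  obtain ⟨y', rfl⟩ := hf k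
  have h1 := hab (f y')
  have hy2 : j y = b (f y') := hy
  rw [hfK, ← hy2, ← sub_eq_zero, ← map_sub, ← map_sub, Submodule.mkQ_apply, Submodule.Quotient.mk_eq_zero] at h1
  obtain ⟨z, hz, hz'⟩ := h1
  have := hj hz'
  subst this
  rwa [SetLike.mem_coe, LinearMap.mem_ker, map_sub, sub_eq_zero] at hz

/-- `Ext^2` vanishing in terms of a projective resolution. -/
theorem isZero_ext_two_iff {R : Type u} [CommRing R] {M : ModuleCat.{u} R}
    (P : ProjectiveResolution M) (N : ModuleCat.{u} R) :
    IsZero (((Ext R (ModuleCat.{u} R) (1 + 1)).obj (Opposite.op M)).obj N) ↔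
    ∀ f : P.complex.X 2 ⟶ N, P.complex.d 3 2 ≫ f = 0 → ∃ g : P.complex.X 1 ⟶ N,
      P.complex.d 2 1 ≫ g = f := by
  rw [(P.isoExt (R := R) (1 + 1) N).isZero_iff, ← HomologicalComplex.exactAt_iff_isZero_homology,
    HomologicalComplex.exactAt_iff' _ 1 2 3 (by simp) (by simp), ShortComplex.moduleCat_exact_iff]
  exact Iff.rfl

theorem isZero_tor_two_iff {R : Type u} [CommRing R] {M : ModuleCat.{u} R}
    (P : ProjectiveResolution M) (N : ModuleCat.{u} R) 
    (h : Function.Exact ((P.complex.d 3 2).hom.rTensor N) ((P.complex.d 2 1).hom.rTensor N)) :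
    IsZero (((Tor' (ModuleCat.{u} R) (1 + 1)).obj M).obj N) := by
  refine IsZero.of_iso ?_ (P.isoLeftDerivedObj ((MonoidalCategory.tensoringRight _).obj N) 2)
  change IsZero (HomologicalComplex.homology _ 2)
  rw [← HomologicalComplex.exactAt_iff_isZero_homology,
    HomologicalComplex.exactAt_iff' _ 3 2 1 (by simp) (by simp), ShortComplex.moduleCat_exact_iff]
  exact fun x hx => (h x).1 hx

theorem resolution_exact {R : Type u} [CommRing R] {M : ModuleCat.{u} R}
    (P : ProjectiveResolution M) (n : ℕ) :
    Function.Exact (P.complex.d (n + 2) (n + 1)).hom (P.complex.d (n + 1) n).hom := by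
  have := P.exact_succ n
  rwa [ShortComplex.ShortExact.moduleCat_exact_iff_function_exact] at this

/-- If all ideals are projective, every module has projective dimension at most one. -/
theorem pdLE_one_of_hereditary {R : Type u} [CommRing R]
    (h : ∀ I : Ideal R, Module.Projective R I) (M : Type u) [AddCommGroup M] [Module R M] :
    pdLE R M 1 := by
  intro N
  let P := projectiveResolution (ModuleCat.of R M)
  rw [isZero_ext_two_iff P]
  intro f hf
  have e32 := resolution_exact P 1
  have e21 := resolution_exact P 0
  have : Module.Projective R (P.complex.X 0) := (IsProjective.iff_projective _).2 (P.projective 0)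
  let d1 := (P.complex.d 1 0).hom
  let d2 := (P.complex.d 2 1).hom
  have : Module.Projective R (LinearMap.range d1) := projective_submodule h _
  obtain ⟨s, hs⟩ := Module.projective_lifting_property d1.rangeRestrict LinearMap.id
    d1.surjective_rangeRestrict
  have hr : ∀ x, (LinearMap.id - s ∘ₗ d1.rangeRestrict : P.complex.X 1 →ₗ[R] P.complex.X 1) x ∈ LinearMap.range d2 := by
    intro x
    refine (e21 _).1 ?_
    have := congrArg Subtype.val (LinearMap.congr_fun hs (d1.rangeRestrict x))
    change d1 (s (d1.rangeRestrict x)) = d1 x at this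
    change d1 (x - s (d1.rangeRestrict x)) = 0
    rw [map_sub, this, sub_self]
  have hker : LinearMap.ker d2 ≤ LinearMap.ker f.hom := by
    intro x hx
    obtain ⟨y, rfl⟩ := (e32 x).1 hx
    exact ConcreteCategory.congr_hom hf y
  let fb : LinearMap.range d2 →ₗ[R] N :=
    (LinearMap.ker d2).liftQ f.hom hker ∘ₗ d2.quotKerEquivRange.symm.toLinearMap
  have hfb : ∀ x, fb (d2.rangeRestrict x) = f.hom x := by
    intro x
    have : d2.quotKerEquivRange.symm (d2.rangeRestrict x) = (LinearMap.ker d2).mkQ x := by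
      rw [LinearEquiv.symm_apply_eq]; rfl
    simp [fb, this]
  refine ⟨ModuleCat.ofHom (fb ∘ₗ LinearMap.codRestrict _ _ hr), ?_⟩
  ext x
  refine Eq.trans ?_ (hfb x)
  change fb _ = fb _
  congr 1
  ext
  change d2 x - s (d1.rangeRestrict (d2 x)) = d2 x
  have : d1.rangeRestrict (d2 x) = 0 := Subtype.ext (e21.apply_apply_eq_zero x)
  rw [this, map_zero, sub_zero]

/-- Modules over a semihereditary ring have flat dimension at most one. -/
theorem fdLE_one_of_semihereditary {R : Type u} [CommRing R]
    (hsemi : ∀ I : Ideal R, I.FG → Module.Projective R I)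
    (M : Type u) [AddCommGroup M] [Module R M] : fdLE R M 1 := by
  intro N
  let P := projectiveResolution (ModuleCat.of R M)
  apply isZero_tor_two_iff P
  have : Module.Projective R (P.complex.X 0) := (IsProjective.iff_projective _).2 (P.projective 0)
  have : Module.Flat R (LinearMap.range (P.complex.d 1 0).hom) := flat_submodule hsemi _
  exact tensor_exact_of_flat _ _ (P.complex.d 1 0).hom (resolution_exact P 1) (resolution_exact P 0)

/-- `pdLE R M 1` implies Mathlib's notion. -/
theorem hasProjectiveDimensionLT_of_pdLE {R : Type u} [CommRing R] (M : Type u) [AddCommGroup M]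
    [Module R M] (h : pdLE R M 1) : HasProjectiveDimensionLT (ModuleCat.of R M) 2 := by
  let P := projectiveResolution (ModuleCat.of R M)
  have e32 := resolution_exact P 1
  have e21 := resolution_exact P 0
  let d1 := (P.complex.d 1 0).hom
  let d2 := (P.complex.d 2 1).hom
  have p0 : Module.Projective R (P.complex.X 0) := (IsProjective.iff_projective _).2 (P.projective 0)
  have p1 : Module.Projective R (P.complex.X 1) := (IsProjective.iff_projective _).2 (P.projective 1)
  obtain ⟨r, hr⟩ := (isZero_ext_two_iff P (ModuleCat.of R (LinearMap.range d2))).1 (h _)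
    (ModuleCat.ofHom d2.rangeRestrict) (by
      ext x
      exact e32.apply_apply_eq_zero x)
  have hr' : ∀ x, r.hom (d2 x) = d2.rangeRestrict x := fun x => ConcreteCategory.congr_hom hr x
  -- the section of `d1`
  have hK : Module.Projective R (LinearMap.range d1) := by
    have hle : LinearMap.ker d1 ≤
        LinearMap.ker (LinearMap.id - (LinearMap.range d2).subtype ∘ₗ r.hom) := by
      intro x hx
      obtain ⟨y, rfl⟩ := (e21 x).1 hx
      change d2 y - (r.hom (d2 y)).1 = 0
      rw [hr']
      exact sub_self _
    refine Module.Projective.of_split (M := P.complex.X 1)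
      ((LinearMap.ker d1).liftQ _ hle ∘ₗ d1.quotKerEquivRange.symm.toLinearMap)
      d1.rangeRestrict ?_
    ext1 z
    obtain ⟨x, rfl⟩ := d1.surjective_rangeRestrict z
    have : d1.quotKerEquivRange.symm (d1.rangeRestrict x) = (LinearMap.ker d1).mkQ x := by
      rw [LinearEquiv.symm_apply_eq]; rfl
    simp only [LinearMap.comp_apply, LinearEquiv.coe_coe, this, Submodule.mkQ_apply,
      Submodule.liftQ_apply]
    ext
    change d1 (x - (r.hom x).1) = d1 x
    obtain ⟨w, hw⟩ := (r.hom x).2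
    rw [map_sub, ← hw, e21.apply_apply_eq_zero w, sub_zero]
  let π : P.complex.X 0 →ₗ[R] M := (P.π.f 0).hom
  have hπ : Function.Surjective π := (ModuleCat.epi_iff_surjective (P.π.f 0)).1 inferInstance
  have hex : Function.Exact d1 π := by
    have := P.exact₀
    rwa [ShortComplex.ShortExact.moduleCat_exact_iff_function_exact] at this
  have hker : LinearMap.ker π = LinearMap.range d1 := hex.linearMap_ker_eq
  have hS := LinearMap.shortExact_shortComplexKer hπ
  refine (hS.hasProjectiveDimensionLT_X₃_iff 0 (P.projective 0)).2 ?_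
  rw [zero_add, ← projective_iff_hasProjectiveDimensionLT_one]
  change Projective (ModuleCat.of R (LinearMap.ker π))
  rw [← IsProjective.iff_projective, hker]
  exact hK

theorem semihereditary_hereditary_iff_strongOnePerfect
    (R : Type u) [CommRing R]
    (hsemi : ∀ I : Ideal R, I.FG → Module.Projective R I) :
    (∀ I : Ideal R, Module.Projective R I) ↔ IsStrongNPerfect R 1 := by
  constructor
  · intro h M _ _ _
    exact pdLE_one_of_hereditary h M
  · intro h I
    have h1 := hasProjectiveDimensionLT_of_pdLE (R ⧸ I) (h _ (fdLE_one_of_semihereditary hsemi _))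
    have hS := LinearMap.shortExact_shortComplexKer (f := I.mkQ) I.mkQ_surjective
    have hR : Projective (ModuleCat.of R R) := (IsProjective.iff_projective _).1 inferInstance
    have h2 := (hS.hasProjectiveDimensionLT_X₃_iff 0 hR).1 h1
    rw [zero_add, ← projective_iff_hasProjectiveDimensionLT_one] at h2
    change Projective (ModuleCat.of R (LinearMap.ker I.mkQ)) at h2
    rwa [← IsProjective.iff_projective, Submodule.ker_mkQ] at h2
end
end
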